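/- arXiv:1403.0372 — 2 statements merged into one kernel-verified Lean document; each statement's English description precedes it below -/
import Mathlib

section
/- Let 1<p<∞. There exists a constant c depending only on p such that for every weight w on ℝ belonging to A_p^+(ℝ), the one-sided (right) Hardy–Littlewood maximal operator M⁺ is bounded on L^p_w(ℝ) with operator norm ‖M⁺‖_{L^p_w(ℝ)} ≤ c ‖w‖_{A_p^+(ℝ)}^{1/(p-1)}. -/
open MeasureTheory Set Filter
open scoped ENNReal

noncomputable section

/-- A weight on `ℝ`: an a.e. positive, locally integrable function. -/
def IsWeight (w : ℝ → ℝ) : Prop :=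
  (∀ᵐ x : ℝ, 0 < w x) ∧ MeasureTheory.LocallyIntegrable w MeasureTheory.volume

/-- `∫_a^b w` as a lower integral. -/
def lintIoc (w : ℝ → ℝ) (a b : ℝ) : ℝ≥0∞ :=
  ∫⁻ t in Set.Ioc a b, ENNReal.ofReal (w t)

/-- Average `(1/(b-a)) ∫_a^b w`. -/
def avgIoc (w : ℝ → ℝ) (a b : ℝ) : ℝ≥0∞ :=
  (ENNReal.ofReal (b - a))⁻¹ * lintIoc w a b

/-- The one-sided Muckenhoupt `A_p^+` characteristic:
`sup_{x, h>0} ((1/h)∫_{x-h}^x w) ((1/h)∫_x^{x+h} w^{1-p'})^{p-1}` with `p' = p/(p-1)`. -/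
def apPlusChar (p : ℝ) (w : ℝ → ℝ) : ℝ≥0∞ :=
  ⨆ (x : ℝ) (h : ℝ) (_ : 0 < h),
    avgIoc w (x - h) x *
      avgIoc (fun t => w t ^ (1 - p / (p - 1))) x (x + h) ^ (p - 1)

/-- Weighted `L^p` "norm" `(∫ g^p w)^{1/p}` of an `ℝ≥0∞`-valued function. -/
def lnormW (p : ℝ) (w : ℝ → ℝ) (g : ℝ → ℝ≥0∞) : ℝ≥0∞ :=
  (∫⁻ x : ℝ, g x ^ p * ENNReal.ofReal (w x)) ^ (1 / p)

/-- One-sided (right) Hardy–Littlewood maximal operator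
`M⁺f(x) = sup_{h>0} (1/h) ∫_x^{x+h} |f|`. -/
def Mplus (f : ℝ → ℝ) (x : ℝ) : ℝ≥0∞ :=
  ⨆ (h : ℝ) (_ : 0 < h),
    (ENNReal.ofReal h)⁻¹ * ∫⁻ t in Set.Ioc x (x + h), ENNReal.ofReal |f t|

lemma realstep (p : ℝ) (hp : 1 < p) (s S c : ℝ) (hs : 0 < s) (hS : s ≤ S) (hc : 0 ≤ c)
    (h2 : S + c ≤ 2 * s) :
    c * (s^p)⁻¹ + (2^p/(p-1)) * ((S+c)^(p-1))⁻¹ ≤ (2^p/(p-1)) * (S^(p-1))⁻¹ := by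
  have hS0 : 0 < S := by linarith
  have hSc : 0 < S + c := by linarith
  have hp1 : 0 < p - 1 := by linarith
  -- Bernoulli
  have hb : 1 + (p-1) * (c/(S+c)) ≤ (S/(S+c))^(-(p-1)) := by
    have hr : 0 < S/(S+c) := by positivity
    rw [Real.rpow_def_of_pos hr]
    have h1 := Real.add_one_le_exp (Real.log (S/(S+c)) * (-(p-1)))
    have h3 := Real.log_le_sub_one_of_pos hr
    have h4 : S/(S+c) - 1 = -(c/(S+c)) := by field_simp; ring
    nlinarith
  have e1 : (S/(S+c))^(-(p-1)) = (S+c)^(p-1) * (S^(p-1))⁻¹ := by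
    rw [Real.rpow_neg (by positivity), Real.div_rpow hS0.le hSc.le]
    field_simp
  rw [e1] at hb
  have hP : 0 < (S+c)^(p-1) := by positivity
  have e2 : (S+c)^p = (S+c)^(p-1) * (S+c) := by
    rw [← Real.rpow_add_one hSc.ne']; congr 1; ring
  have h5 : (S+c)^p ≤ 2^p * s^p := by
    rw [← Real.mul_rpow (by norm_num) hs.le]
    exact Real.rpow_le_rpow hSc.le h2 (by linarith)
  have hsp : 0 < s^p := by positivity
  have h6 : (s^p)⁻¹ ≤ 2^p * ((S+c)^p)⁻¹ := by
    rw [← div_eq_mul_inv, le_div_iff₀ (by positivity), inv_mul_le_iff₀ hsp]; linarith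
  have h7 : ((S+c)^(p-1))⁻¹ + (p-1) * c * ((S+c)^p)⁻¹ ≤ (S^(p-1))⁻¹ := by
    have := mul_le_mul_of_nonneg_left hb (inv_nonneg.2 hP.le)
    rw [← mul_assoc, inv_mul_cancel₀ hP.ne', one_mul] at this
    refine le_trans (le_of_eq ?_) this
    rw [e2]; field_simp
  calc _ ≤ c * (2^p * ((S+c)^p)⁻¹) + (2^p/(p-1)) * ((S+c)^(p-1))⁻¹ := by gcongr
    _ = (2^p/(p-1)) * (((S+c)^(p-1))⁻¹ + (p-1) * c * ((S+c)^p)⁻¹) := by field_simp; ring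
    _ ≤ _ := by gcongr

/-- constant -/
def KK (p : ℝ) : ℝ≥0∞ := ENNReal.ofReal (2^p/(p-1))

lemma estep (p : ℝ) (hp : 1 < p) (s S c G : ℝ≥0∞) (hs : s ≠ 0) (hs' : s ≠ ⊤) (hS : s ≤ S)
    (h2 : S + c ≤ 2 * s) :
    c * (G/s)^p + KK p * (G^p / (S+c)^(p-1)) ≤ KK p * (G^p / S^(p-1)) := by
  have hSc : S + c ≠ ⊤ := ne_top_of_le_ne_top (ENNReal.mul_ne_top (by simp) hs') h2
  have hSt : S ≠ ⊤ := fun h => hSc (by simp [h])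
  have hct : c ≠ ⊤ := fun h => hSc (by simp [h])
  lift s to NNReal using hs'
  lift S to NNReal using hSt
  lift c to NNReal using hct
  have hs0 : 0 < s := by
    rw [pos_iff_ne_zero]; exact_mod_cast hs
  have hS0 : s ≤ S := by exact_mod_cast hS
  have h20 : S + c ≤ 2 * s := by exact_mod_cast h2
  have hp1 : 0 < p - 1 := by linarith
  have key : (c:ℝ≥0∞) * ((s:ℝ≥0∞)^p)⁻¹ + KK p * (((S:ℝ≥0∞)+c)^(p-1))⁻¹ ≤ KK p * ((S:ℝ≥0∞)^(p-1))⁻¹ := by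
    have := realstep p hp s S c (by exact_mod_cast hs0) (by exact_mod_cast hS0) c.2 (by exact_mod_cast h20)
    have h3 := ENNReal.ofReal_le_ofReal this
    have hspos : (0:ℝ) < s := by exact_mod_cast hs0
    have hSpos : (0:ℝ) < S := lt_of_lt_of_le hspos (by exact_mod_cast hS0)
    have hcpos : (0:ℝ) ≤ c := c.2
    have hScpos : (0:ℝ) < S + c := by linarith
    rw [ENNReal.ofReal_add (by positivity) (by positivity), ENNReal.ofReal_mul (by positivity),
      ENNReal.ofReal_mul (by positivity), ENNReal.ofReal_mul (by positivity),
      ENNReal.ofReal_inv_of_pos (by positivity), ENNReal.ofReal_inv_of_pos (by positivity),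
      ENNReal.ofReal_inv_of_pos (by positivity), ← ENNReal.ofReal_rpow_of_pos hspos,
      ← ENNReal.ofReal_rpow_of_pos hSpos, ← ENNReal.ofReal_rpow_of_pos hScpos,
      ENNReal.ofReal_add hSpos.le hcpos] at h3
    simpa [KK] using h3
  calc _ = G^p * ((c:ℝ≥0∞) * ((s:ℝ≥0∞)^p)⁻¹ + KK p * (((S:ℝ≥0∞)+c)^(p-1))⁻¹) := by
        rw [ENNReal.div_rpow_of_nonneg _ _ (by linarith), div_eq_mul_inv, div_eq_mul_inv]; ring
    _ ≤ G^p * (KK p * ((S:ℝ≥0∞)^(p-1))⁻¹) := by gcongr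
    _ = _ := by rw [div_eq_mul_inv]; ring

lemma radon (p : ℝ) (hp : 1 < p) (S0 S1 G0 G1 : ℝ≥0∞) (h0 : S0 ≠ 0) (h0' : S0 ≠ ⊤) (h1 : S1 ≠ 0)
    (h1' : S1 ≠ ⊤) : (G0+G1)^p/(S0+S1)^(p-1) ≤ G0^p/S0^(p-1) + G1^p/S1^(p-1) := by
  have hS : S0 + S1 ≠ 0 := by simp [h0]
  have hS' : S0 + S1 ≠ ⊤ := by simp [h0', h1']
  have hp1 : 0 < p - 1 := by linarith
  have hw : S0/(S0+S1) + S1/(S0+S1) = 1 := by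
    rw [← ENNReal.add_div]; exact ENNReal.div_self hS hS'
  have := ENNReal.rpow_arith_mean_le_arith_mean2_rpow (S0/(S0+S1)) (S1/(S0+S1)) (G0/S0) (G1/S1) hw hp.le
  have e : ∀ S G : ℝ≥0∞, S ≠ 0 → S ≠ ⊤ → S/(S0+S1) * (G/S) = G/(S0+S1) := by
    intro S G h h'
    rw [div_eq_mul_inv, div_eq_mul_inv, div_eq_mul_inv]
    calc _ = G * (S0+S1)⁻¹ * (S * S⁻¹) := by ring
      _ = _ := by rw [ENNReal.mul_inv_cancel h h', mul_one]
  have e2 : ∀ S G : ℝ≥0∞, S ≠ 0 → S ≠ ⊤ → S * (G/S)^p = G^p/S^(p-1) := by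
    intro S G h h'
    rw [ENNReal.div_rpow_of_nonneg _ _ (by linarith), ENNReal.rpow_sub _ _ h h', ENNReal.rpow_one,
      div_eq_mul_inv, div_eq_mul_inv, ENNReal.div_eq_inv_mul, ENNReal.mul_inv (by simp [h, h']) (by simp [h, h']), inv_inv]
    ring
  rw [e _ _ h0 h0', e _ _ h1 h1', ← ENNReal.add_div] at this
  rw [← e2 _ _ h0 h0', ← e2 _ _ h1 h1', ← e2 _ _ hS hS']
  calc _ ≤ (S0+S1) * (S0/(S0+S1) * (G0/S0)^p + S1/(S0+S1) * (G1/S1)^p) := by gcongr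
    _ = (S0+S1) * (S0+S1)⁻¹ * (S0 * (G0/S0)^p + S1 * (G1/S1)^p) := by
      rw [div_eq_mul_inv S0, div_eq_mul_inv S1]; ring
    _ = _ := by rw [ENNReal.mul_inv_cancel hS hS', one_mul]

def tS (c : ℕ → ℝ → ℝ → ℝ≥0∞) : ℕ → ℝ → ℝ → ℝ≥0∞
  | 0, _, _ => 0
  | n+1, a, l => c n a l + tS c n a (l/2) + tS c n (a+l/2) (l/2)

lemma carleson (p : ℝ) (hp : 1 < p) (s G F : ℝ → ℝ → ℝ≥0∞) (cL cR : ℕ → ℝ → ℝ → ℝ≥0∞)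
    (hs0 : ∀ a l, 0 < l → s a l ≠ 0) (hst : ∀ a l, 0 < l → s a l ≠ ⊤)
    (hs : ∀ a l, 0 < l → s a l = s a (l/2) + s (a+l/2) (l/2))
    (hG : ∀ a l, 0 < l → G a l = G a (l/2) + G (a+l/2) (l/2))
    (hF : ∀ a l, 0 < l → F a l = F a (l/2) + F (a+l/2) (l/2))
    (hH : ∀ a l, 0 < l → G a l ^ p ≤ F a l * s a l ^ (p-1))
    (hL : ∀ n a l, 0 < l → cL n a l + tS (fun n a l => cL n a l + cR n a l) n a (l/2) ≤ s a (l/2))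
    (hR : ∀ n a l, 0 < l → cR n a l + tS (fun n a l => cL n a l + cR n a l) n (a+l/2) (l/2)
      ≤ s (a+l/2) (l/2)) (n : ℕ) : ∀ a l, 0 < l →
    tS (fun n a l => cL n a l * (G a (l/2) / s a (l/2))^p
      + cR n a l * (G (a+l/2) (l/2) / s (a+l/2) (l/2))^p) n a l
     + KK p * (G a l ^ p / (s a l + tS (fun n a l => cL n a l + cR n a l) n a l)^(p-1))
    ≤ KK p * F a l := by
  induction n with
  | zero =>
    intro a l hl
    simp only [tS, zero_add, add_zero]
    gcongr
    refine ENNReal.div_le_of_le_mul (hH a l hl)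
  | succ n ih =>
    intro a l hl
    have hl2 : 0 < l/2 := by linarith
    have i0 := ih a (l/2) hl2
    have i1 := ih (a+l/2) (l/2) hl2
    have hL' := hL n a l hl
    have hR' := hR n a l hl
    simp only [tS]
    rw [hF a l hl, hs a l hl, hG a l hl]
    set X0 := tS (fun n a l => cL n a l * (G a (l/2) / s a (l/2))^p
      + cR n a l * (G (a+l/2) (l/2) / s (a+l/2) (l/2))^p) n a (l/2)
    set X1 := tS (fun n a l => cL n a l * (G a (l/2) / s a (l/2))^p
      + cR n a l * (G (a+l/2) (l/2) / s (a+l/2) (l/2))^p) n (a+l/2) (l/2)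
    set T0 := tS (fun n a l => cL n a l + cR n a l) n a (l/2)
    set T1 := tS (fun n a l => cL n a l + cR n a l) n (a+l/2) (l/2)
    have n0 := hs0 a (l/2) hl2
    have t0 := hst a (l/2) hl2
    have n1 := hs0 (a+l/2) (l/2) hl2
    have t1 := hst (a+l/2) (l/2) hl2
    set s0 := s a (l/2)
    set s1 := s (a+l/2) (l/2)
    have b0 : (s0 + T0) + cL n a l ≤ 2 * s0 := by
      rw [two_mul, add_assoc, add_comm T0]; gcongr
    have b1 : (s1 + T1) + cR n a l ≤ 2 * s1 := by
      rw [two_mul, add_assoc, add_comm T1]; gcongr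
    have j0 := estep p hp s0 (s0+T0) (cL n a l) (G a (l/2)) n0 t0 le_self_add b0
    have j1 := estep p hp s1 (s1+T1) (cR n a l) (G (a+l/2) (l/2)) n1 t1 le_self_add b1
    have r := radon p hp (s0+T0+cL n a l) (s1+T1+cR n a l) (G a (l/2)) (G (a+l/2) (l/2))
      (by simp [n0]) (ne_top_of_le_ne_top (ENNReal.mul_ne_top (by simp) t0) b0)
      (by simp [n1]) (ne_top_of_le_ne_top (ENNReal.mul_ne_top (by simp) t1) b1)
    have e : s0 + s1 + (cL n a l + cR n a l + T0 + T1) = s0+T0+cL n a l + (s1+T1+cR n a l) := by ring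
    rw [e]
    set g0 := G a (l/2)
    set g1 := G (a+l/2) (l/2)
    calc _ ≤ cL n a l * (g0/s0)^p + cR n a l * (g1/s1)^p + X0 + X1 +
          KK p * (g0^p/(s0+T0+cL n a l)^(p-1) + g1^p/(s1+T1+cR n a l)^(p-1)) := by gcongr
      _ = X0 + (cL n a l * (g0/s0)^p + KK p * (g0^p/(s0+T0+cL n a l)^(p-1))) +
          (X1 + (cR n a l * (g1/s1)^p + KK p * (g1^p/(s1+T1+cR n a l)^(p-1)))) := by ring
      _ ≤ X0 + KK p * (g0^p/(s0+T0)^(p-1)) + (X1 + KK p * (g1^p/(s1+T1)^(p-1))) := by gcongr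
      _ ≤ _ := by rw [mul_add]; gcongr

end
open MeasureTheory Set Filter
open scoped ENNReal
noncomputable section

/-- integral over `[a,a+l)` -/
def II (φ : ℝ → ℝ≥0∞) (a l : ℝ) : ℝ≥0∞ := ∫⁻ x in Ico a (a+l), φ x

lemma II_split' (φ : ℝ → ℝ≥0∞) (a l m : ℝ) (hl : 0 ≤ l) (hm : 0 ≤ m) :
    II φ a (l+m) = II φ a l + II φ (a+l) m := by
  unfold II
  rw [← lintegral_union measurableSet_Ico]
  · rw [← add_assoc, Ico_union_Ico_eq_Ico (by linarith) (by linarith)]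
  · rw [Set.disjoint_left]; intro x hx hx'; exact absurd hx.2 (not_lt.2 hx'.1)

lemma II_split (φ : ℝ → ℝ≥0∞) (a l : ℝ) (hl : 0 < l) :
    II φ a l = II φ a (l/2) + II φ (a+l/2) (l/2) := by
  rw [← II_split' φ a (l/2) (l/2) (by linarith) (by linarith)]; congr 1; ring

lemma II_one (a l : ℝ) : II (fun _ => 1) a l = ENNReal.ofReal l := by
  simp [II]

lemma II_mono {φ ψ : ℝ → ℝ≥0∞} (h : ∀ x, φ x ≤ ψ x) (a l : ℝ) : II φ a l ≤ II ψ a l :=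
  lintegral_mono h

lemma II_add {φ ψ : ℝ → ℝ≥0∞} (h : Measurable φ) (a l : ℝ) :
    II (fun x => φ x + ψ x) a l = II φ a l + II ψ a l :=
  lintegral_add_left h _

lemma II_ne_zero {φ : ℝ → ℝ≥0∞} (hm : Measurable φ) (h : ∀ x, φ x ≠ 0) (a l : ℝ) (hl : 0 < l) :
    II φ a l ≠ 0 := by
  unfold II
  rw [Ne, lintegral_eq_zero_iff hm]
  intro h0
  have : ∀ᵐ x ∂(volume.restrict (Ico a (a+l))), False := by
    filter_upwards [h0] with x hx using h x hx
  rw [ae_iff] at this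
  simp at this
  linarith

lemma hold (r : ℝ) (hr : 1 < r) (f φ v : ℝ → ℝ≥0∞) (hφ : Measurable φ) (hv : Measurable v)
    (hf : ∀ x, f x = φ x ^ (1/r) * v x ^ ((r-1)/r)) (a l : ℝ) :
    II f a l ^ r ≤ II φ a l * II v a l ^ (r-1) := by
  have h := ENNReal.lintegral_mul_norm_pow_le (μ := volume.restrict (Ico a (a+l)))
    hφ.aemeasurable hv.aemeasurable (p := 1/r) (q := (r-1)/r) (by positivity)
    (div_nonneg (by linarith) (by linarith)) (by field_simp; ring)
  have h2 : II f a l ≤ II φ a l ^ (1/r) * II v a l ^ ((r-1)/r) := by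
    refine le_trans (le_of_eq ?_) h
    unfold II; simp_rw [hf]
  calc _ ≤ (II φ a l ^ (1/r) * II v a l ^ ((r-1)/r))^r := by gcongr
    _ = _ := by
      rw [ENNReal.mul_rpow_of_nonneg _ _ (by linarith), ← ENNReal.rpow_mul, ← ENNReal.rpow_mul]
      rw [div_mul_cancel₀ _ (by linarith), div_mul_cancel₀ _ (by linarith), ENNReal.rpow_one]

lemma tS_mono {c d : ℕ → ℝ → ℝ → ℝ≥0∞} (h : ∀ n a l, 0 < l → c n a l ≤ d n a l) (n : ℕ) :
    ∀ a l, 0 < l → tS c n a l ≤ tS d n a l := by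
  induction n with
  | zero => intro a l _; simp [tS]
  | succ n ih =>
    intro a l hl
    simp only [tS]
    have := h n a l hl
    have := ih a (l/2) (by linarith)
    have := ih (a+l/2) (l/2) (by linarith)
    gcongr

lemma tS_smul (k : ℝ≥0∞) {c : ℕ → ℝ → ℝ → ℝ≥0∞} (n : ℕ) :
    ∀ a l, tS (fun n a l => k * c n a l) n a l = k * tS c n a l := by
  induction n with
  | zero => intro a l; simp [tS]
  | succ n ih =>
    intro a l
    simp only [tS, ih]; ring

/-- sets of hypotheses on the pair of weights -/
structure Good (p : ℝ) (T : ℝ≥0∞) (W V : ℝ → ℝ≥0∞) : Prop where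
  hp : 1 < p
  mW : Measurable W
  mV : Measurable V
  W0 : ∀ x, W x ≠ 0
  Wt : ∀ x, W x ≠ ⊤
  hV : ∀ x, V x = W x ^ (-(1/(p-1)))
  IWt : ∀ a l, II W a l ≠ ⊤
  hT : T ≠ ⊤
  hA : ∀ a l, 0 < l → II W a l * II V (a+l) l ^ (p-1) ≤ T * ENNReal.ofReal l ^ p

variable {p : ℝ} {T : ℝ≥0∞} {W V : ℝ → ℝ≥0∞}

lemma Good.V0 (h : Good p T W V) (x : ℝ) : V x ≠ 0 := by
  rw [h.hV]; simp [h.W0, h.Wt]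

lemma Good.IW0 (h : Good p T W V) (a l : ℝ) (hl : 0 < l) : II W a l ≠ 0 :=
  II_ne_zero h.mW h.W0 a l hl

lemma Good.IV0 (h : Good p T W V) (a l : ℝ) (hl : 0 < l) : II V a l ≠ 0 :=
  II_ne_zero h.mV h.V0 a l hl

lemma Good.IVt (h : Good p T W V) (a l : ℝ) (hl : 0 < l) : II V a l ≠ ⊤ := by
  have hp := h.hp
  intro ht
  have := h.hA (a-l) l hl
  rw [sub_add_cancel, ht, ENNReal.top_rpow_of_pos (by linarith), ENNReal.mul_top (h.IW0 _ _ hl)] at this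
  exact ENNReal.mul_ne_top h.hT (ENNReal.rpow_ne_top_of_nonneg (by linarith) (by simp)) (top_le_iff.1 this)

lemma Good.holder1 (h : Good p T W V) (a l : ℝ) :
    ENNReal.ofReal l ^ (p/(p-1)) ≤ II V a l * II W a l ^ (p/(p-1)-1) := by
  have hp := h.hp
  have hp1 : 0 < p - 1 := by linarith
  rw [← II_one a l]
  refine hold _ ?_ _ V W h.mV h.mW ?_ a l
  · rw [lt_div_iff₀ hp1]; linarith
  · intro x
    rw [h.hV, ← ENNReal.rpow_mul, ← ENNReal.rpow_add _ _ (h.W0 x) (h.Wt x)]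
    have : -(1 / (p - 1)) * (1 / (p / (p - 1))) + (p / (p - 1) - 1) / (p / (p - 1)) = 0 := by
      field_simp; ring
    rw [this, ENNReal.rpow_zero]

lemma Good.holder2 (h : Good p T W V) (f : ℝ → ℝ≥0∞) (hf : Measurable f) (a l : ℝ) :
    II f a l ^ p ≤ II (fun x => f x ^ p * W x) a l * II V a l ^ (p-1) := by
  have hp := h.hp
  have hp1 : 0 < p - 1 := by linarith
  refine hold p hp _ (fun x => f x ^ p * W x) V ((hf.pow_const p).mul h.mW) h.mV ?_ a l
  intro x
  rw [h.hV, ENNReal.mul_rpow_of_nonneg _ _ (by positivity), ← ENNReal.rpow_mul, ← ENNReal.rpow_mul,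
    mul_assoc, ← ENNReal.rpow_add _ _ (h.W0 x) (h.Wt x)]
  have : 1 / p + -(1 / (p - 1)) * ((p - 1) / p) = 0 := by
      field_simp; ring
  rw [this, ENNReal.rpow_zero, mul_one_div_cancel (by linarith), ENNReal.rpow_one, mul_one]

/-- `V(J+) ≤ T^{1/(p-1)} V(J)` -/
lemma Good.next (h : Good p T W V) (a l : ℝ) (hl : 0 < l) :
    II V (a+l) l ≤ T^(1/(p-1)) * II V a l := by
  have hp := h.hp
  have hp1 : 0 < p - 1 := by linarith
  have h1 := h.hA a l hl
  have h2 : ENNReal.ofReal l ^ p ≤ II W a l * II V a l ^ (p-1) := by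
    have := ENNReal.rpow_le_rpow (h.holder1 a l) hp1.le
    rw [ENNReal.mul_rpow_of_nonneg _ _ hp1.le, ← ENNReal.rpow_mul, ← ENNReal.rpow_mul] at this
    have e1 : p / (p-1) * (p-1) = p := by field_simp
    have e2 : (p / (p-1) - 1) * (p-1) = 1 := by field_simp; ring
    rw [e1, e2, ENNReal.rpow_one, mul_comm] at this
    exact this
  have h3 : II W a l * II V (a+l) l ^ (p-1) ≤ II W a l * (T * II V a l ^ (p-1)) := by
    calc _ ≤ _ := h1
      _ ≤ T * (II W a l * II V a l ^ (p-1)) := by gcongr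
      _ = _ := by ring
  rw [ENNReal.mul_le_mul_iff_right (h.IW0 a l hl) (h.IWt a l)] at h3
  have := ENNReal.rpow_le_rpow h3 (z := 1/(p-1)) (by positivity)
  rw [ENNReal.mul_rpow_of_nonneg _ _ (by positivity), ← ENNReal.rpow_mul, ← ENNReal.rpow_mul,
    mul_one_div_cancel hp1.ne', ENNReal.rpow_one, ENNReal.rpow_one] at this
  exact this

lemma Good.next_k (h : Good p T W V) (k : ℕ) : ∀ a l, 0 < l →
    II V (a+l) l ≤ (T^(1/(p-1)))^(k+1) * II V a l := by
  induction k with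
  | zero => intro a l hl; simpa using h.next a l hl
  | succ k ih =>
    intro a l hl
    have hl2 : 0 < l/2 := by linarith
    have a1 := h.next a (l/2) hl2
    have a2 := ih (a+l/2) (l/2) hl2
    have a2' := h.next (a+l/2) (l/2) hl2
    have a3 := ih (a+l/2+l/2) (l/2) hl2
    rw [II_split V (a+l) l hl, II_split V a l hl]
    have e : a + l/2 + l/2 = a + l := by ring
    rw [e] at a2 a2' a3
    set ρ := T^(1/(p-1))
    calc _ ≤ ρ^(k+1) * (ρ * II V a (l/2)) + ρ^(k+1) * (ρ * II V (a+l/2) (l/2)) := by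
          gcongr
          · exact a2.trans (mul_le_mul_right a1 _)
          · exact a3.trans (mul_le_mul_right a2' _)
      _ = _ := by ring

lemma Good.one_le (h : Good p T W V) : 1 ≤ T := by
  have hp := h.hp
  have hp1 : 0 < p - 1 := by linarith
  by_contra! hT
  have hρ : T^(1/(p-1)) < 1 := ENNReal.rpow_lt_one hT (by positivity)
  have ht := ENNReal.tendsto_pow_atTop_nhds_zero_of_lt_one hρ
  have ht2 := (ENNReal.Tendsto.mul_const (b := II V 0 1) ht (Or.inr (h.IVt 0 1 one_pos))).comp (tendsto_add_atTop_nat 1)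
  rw [zero_mul] at ht2
  have := ge_of_tendsto' ht2 (fun k => h.next_k k 0 1 one_pos)
  exact h.IV0 (0+1) 1 one_pos (le_antisymm this bot_le)

end
open MeasureTheory Set Filter
open scoped ENNReal
noncomputable section
variable {p : ℝ} {T : ℝ≥0∞} {W V : ℝ → ℝ≥0∞}

lemma tS_e (e : ℕ → ℝ → ℝ≥0∞) (he : ∀ i, Measurable (e i)) (n : ℕ) : ∀ a l, 0 < l →
    tS (fun n a l => II (e n) a (l/2)) n a l ≤ II (fun x => ∑ i ∈ Finset.range n, e i x) a l := by
  induction n with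
  | zero => intro a l _; simp [tS]
  | succ n ih =>
    intro a l hl
    have hl2 : 0 < l/2 := by linarith
    have hm : Measurable (fun x => ∑ i ∈ Finset.range n, e i x) :=
      Finset.measurable_fun_sum _ (fun i _ => he i)
    simp only [tS, Finset.sum_range_succ]
    rw [II_add hm, II_split _ a l hl, II_split (e n) a l hl]
    calc _ ≤ II (e n) a (l/2) + II (fun x => ∑ i ∈ Finset.range n, e i x) a (l/2) +
          II (fun x => ∑ i ∈ Finset.range n, e i x) (a+l/2) (l/2) := by
          gcongr
          · exact ih _ _ hl2
          · exact ih _ _ hl2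
      _ ≤ II (e n) a (l/2) + II (fun x => ∑ i ∈ Finset.range n, e i x) a (l/2) +
          II (fun x => ∑ i ∈ Finset.range n, e i x) (a+l/2) (l/2) + II (e n) (a+l/2) (l/2) := le_self_add
      _ = _ := by ring

lemma Good.test (h : Good p T W V) (e : ℕ → ℝ → ℝ≥0∞) (he : ∀ i, Measurable (e i))
    (hW : ∀ m x, ∑ i ∈ Finset.range m, e i x ≤ W x) (n : ℕ) (a l : ℝ) (hl : 0 < l) :
    tS (fun n a l => II (e n) a (l/2) * (ENNReal.ofReal (l/2) / II W a (l/2))^(p/(p-1))) n a l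
      ≤ KK (p/(p-1)) * II V a l := by
  have hp := h.hp
  have hp1 : 0 < p - 1 := by linarith
  have hq : 1 < p/(p-1) := by rw [lt_div_iff₀ hp1]; linarith
  have key := carleson (p/(p-1)) hq (II W) (fun a l => ENNReal.ofReal l) (II V)
    (fun n a l => II (e n) a (l/2)) (fun _ _ _ => 0) h.IW0 (fun a l _ => h.IWt a l)
    (II_split W) (fun a l hl => by rw [← ENNReal.ofReal_add (by linarith) (by linarith)]; congr 1; ring)
    (II_split V) (fun a l _ => h.holder1 a l)
    (by
      intro n a l hl
      simp only [add_zero]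
      have hm : Measurable (fun x => ∑ i ∈ Finset.range n, e i x) :=
        Finset.measurable_fun_sum _ (fun i _ => he i)
      calc _ ≤ II (e n) a (l/2) + II (fun x => ∑ i ∈ Finset.range n, e i x) a (l/2) := by
            gcongr; exact tS_e e he n _ _ (by linarith)
        _ = II (fun x => ∑ i ∈ Finset.range (n+1), e i x) a (l/2) := by
            simp only [Finset.sum_range_succ]; rw [II_add hm, add_comm]
        _ ≤ _ := II_mono (hW _) _ _)
    (by
      intro n a l hl
      simp only [add_zero, zero_add]
      exact (tS_e e he n _ _ (by linarith)).trans (II_mono (hW _) _ _))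
    n a l hl
  simp only [zero_mul, add_zero] at key
  exact le_trans le_self_add key

lemma Good.b1 (h : Good p T W V) (a m : ℝ) (hm : 0 < m) :
    (II V (a+m) m / ENNReal.ofReal m)^p ≤
      T^(p/(p-1)) * (ENNReal.ofReal m / II W a m)^(p/(p-1)) := by
  have hp := h.hp
  have hp1 : 0 < p - 1 := by linarith
  have h1 := h.hA a m hm
  have hW0 := h.IW0 a m hm
  have hWt := h.IWt a m
  set L := ENNReal.ofReal m with hL
  have hL0 : L ≠ 0 := by simp [hL, hm]
  have hLt : L ≠ ⊤ := by simp [hL]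
  have h2 : (II V (a+m) m / L)^(p-1) ≤ T * (L / II W a m) := by
    rw [ENNReal.div_rpow_of_nonneg _ _ hp1.le]
    refine ENNReal.div_le_of_le_mul ?_
    rw [← mul_div_assoc, ENNReal.mul_comm_div, ← mul_div_assoc, ENNReal.le_div_iff_mul_le (Or.inl hW0) (Or.inl hWt)]
    rw [mul_comm]
    refine h1.trans (le_of_eq ?_)
    rw [mul_assoc]
    congr 1
    nth_rewrite 2 [← ENNReal.rpow_one L]
    rw [← ENNReal.rpow_add _ _ hL0 hLt]; congr 1; ring
  have := ENNReal.rpow_le_rpow h2 (z := p/(p-1)) (by positivity)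
  rw [← ENNReal.rpow_mul, ENNReal.mul_rpow_of_nonneg _ _ (by positivity), mul_div_cancel₀ _ hp1.ne'] at this
  exact this

lemma Good.b2 (h : Good p T W V) (a m : ℝ) (hm : 0 < m) :
    II W a m * (II V (a+m) m / ENNReal.ofReal m)^p ≤ T * II V (a+m) m := by
  have hp := h.hp
  have hp1 : 0 < p - 1 := by linarith
  have h1 := h.hA a m hm
  have hV0 := h.IV0 (a+m) m hm
  have hVt := h.IVt (a+m) m hm
  set L := ENNReal.ofReal m with hL
  have hL0 : L ≠ 0 := by simp [hL, hm]
  have hLt : L ≠ ⊤ := by simp [hL]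
  rw [ENNReal.div_rpow_of_nonneg _ _ (by linarith), ← mul_div_assoc]
  refine ENNReal.div_le_of_le_mul ?_
  have e : II V (a+m) m ^ p = II V (a+m) m ^ (p-1) * II V (a+m) m := by
    nth_rewrite 3 [← ENNReal.rpow_one (II V (a+m) m)]
    rw [← ENNReal.rpow_add _ _ hV0 hVt]; congr 1; ring
  rw [e, ← mul_assoc]
  calc _ ≤ (T * L^p) * II V (a+m) m := by gcongr
    _ = _ := by ring

/-- main constant -/
def AA (p : ℝ) (T : ℝ≥0∞) : ℝ≥0∞ := (KK (p/(p-1)) + 1) * T^(p/(p-1))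

lemma Good.strong (h : Good p T W V) (e : ℕ → ℝ → ℝ≥0∞) (he : ∀ i, Measurable (e i))
    (hW : ∀ m x, ∑ i ∈ Finset.range m, e i x ≤ W x) (f : ℝ → ℝ≥0∞) (hf : Measurable f)
    (n : ℕ) (a l : ℝ) (hl : 0 < l) :
    tS (fun n a l => II (e n) a (l/2) * (II f (a+l/2) (l/2) / ENNReal.ofReal (l/2))^p) n a l
      ≤ AA p T * KK p * II (fun x => f x ^ p * W x) a l := by
  have hp := h.hp
  have hp1 : 0 < p - 1 := by linarith
  have hq : 1 < p/(p-1) := by rw [lt_div_iff₀ hp1]; linarith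
  have hT1 := h.one_le
  have hTT : T ≤ T^(p/(p-1)) := by
    nth_rewrite 1 [← ENNReal.rpow_one T]
    exact ENNReal.rpow_le_rpow_of_exponent_le hT1 hq.le
  have hA0 : AA p T ≠ 0 := by
    unfold AA
    refine mul_ne_zero (by simp) ?_
    exact (lt_of_lt_of_le one_pos (hT1.trans hTT)).ne'
  have hAt : AA p T ≠ ⊤ := by
    unfold AA KK
    exact ENNReal.mul_ne_top (by simp) (ENNReal.rpow_ne_top_of_nonneg (by positivity) h.hT)
  set γ : ℕ → ℝ → ℝ → ℝ≥0∞ := fun n a l =>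
    II (e n) a (l/2) * (II V (a+l/2) (l/2) / ENNReal.ofReal (l/2))^p with hγ
  have g1 : ∀ n a l, 0 < l → tS γ n a l ≤ T^(p/(p-1)) * (KK (p/(p-1)) * II V a l) := by
    intro n a l hl
    refine le_trans (tS_mono (d := fun n a l => T^(p/(p-1)) *
      (II (e n) a (l/2) * (ENNReal.ofReal (l/2) / II W a (l/2))^(p/(p-1)))) ?_ n a l hl) ?_
    · intro n a l hl
      calc _ ≤ II (e n) a (l/2) * (T^(p/(p-1)) * (ENNReal.ofReal (l/2) / II W a (l/2))^(p/(p-1))) := by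
            simp only [hγ]; gcongr; exact h.b1 _ _ (by linarith)
        _ = _ := by ring
    · rw [tS_smul]
      gcongr
      exact h.test e he hW n a l hl
  have g2 : ∀ n a l, 0 < l → γ n a l ≤ T^(p/(p-1)) * II V (a+l/2) (l/2) := by
    intro n a l hl
    calc _ ≤ II W a (l/2) * (II V (a+l/2) (l/2) / ENNReal.ofReal (l/2))^p := by
          simp only [hγ]; gcongr
          refine II_mono (fun x => le_trans ?_ (hW (n+1) x)) _ _
          rw [Finset.sum_range_succ]; exact le_add_self
      _ ≤ _ := h.b2 a (l/2) (by linarith)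
      _ ≤ _ := by gcongr
  have key := carleson p hp (II V) (II f) (II (fun x => f x ^ p * W x))
    (fun _ _ _ => 0) (fun n a l => (AA p T)⁻¹ * γ n a l) h.IV0 h.IVt
    (II_split V) (II_split f) (II_split _) (fun a l _ => h.holder2 f hf a l)
    (by
      intro n a l hl
      simp only [zero_add]
      rw [tS_smul, ENNReal.inv_mul_le_iff hA0 hAt]
      refine (g1 n a (l/2) (by linarith)).trans ?_
      rw [← mul_assoc, mul_comm (T^_)]; unfold AA
      gcongr
      exact le_self_add)
    (by
      intro n a l hl
      simp only [zero_add]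
      rw [tS_smul, ← mul_add, ENNReal.inv_mul_le_iff hA0 hAt]
      refine (add_le_add (g2 n a l hl) (g1 n (a+l/2) (l/2) (by linarith))).trans (le_of_eq ?_)
      unfold AA; ring)
    n a l hl
  simp only [zero_mul, zero_add] at key
  have key2 := le_trans le_self_add key
  simp only [mul_assoc] at key2
  rw [tS_smul, ENNReal.inv_mul_le_iff hA0 hAt] at key2
  rw [mul_assoc]
  refine le_trans (tS_mono ?_ n a l hl) key2
  intro n a l hl
  rw [hγ]
  simp only
  rw [mul_assoc, ← ENNReal.mul_rpow_of_nonneg _ _ (by linarith : 0 ≤ p)]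
  apply le_of_eq
  congr 2
  have := ENNReal.mul_inv_cancel (h.IV0 (a+l/2) (l/2) (by linarith)) (h.IVt (a+l/2) (l/2) (by linarith))
  generalize II V (a+l/2) (l/2) = v at *
  generalize II f (a+l/2) (l/2) = u at *
  generalize ENNReal.ofReal (l/2) = z at *
  rw [div_eq_mul_inv u, div_eq_mul_inv v, div_eq_mul_inv u]
  calc u * z⁻¹ = u * z⁻¹ * (v * v⁻¹) := by rw [this, mul_one]
    _ = _ := by ring

/-- dyadic one-sided maximal function -/
def Md (f : ℝ → ℝ≥0∞) : ℕ → ℝ → ℝ → ℝ → ℝ≥0∞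
  | 0, _, _, _ => 0
  | n+1, a, l, x => if x < a + l/2 then
      max (II f (a+l/2) (l/2) / ENNReal.ofReal (l/2)) (Md f n a (l/2) x)
      else Md f n (a+l/2) (l/2) x

lemma Md_meas (f : ℝ → ℝ≥0∞) (n : ℕ) : ∀ a l, Measurable (Md f n a l) := by
  induction n with
  | zero => intro a l; exact measurable_const
  | succ n ih =>
    intro a l
    exact Measurable.ite measurableSet_Iio (measurable_const.max (ih _ _)) (ih _ _)

lemma II_congr {φ ψ : ℝ → ℝ≥0∞} {a l : ℝ} (h : ∀ x ∈ Ico a (a+l), φ x = ψ x) :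
    II φ a l = II ψ a l := setLIntegral_congr_fun measurableSet_Ico h

lemma tS_congr (g : ℝ → ℝ → ℝ≥0∞) (e e' : ℕ → ℝ → ℝ≥0∞) (n : ℕ) : ∀ a l, 0 < l →
    (∀ i < n, ∀ x ∈ Ico a (a+l), e i x = e' i x) →
    tS (fun n a l => II (e n) a (l/2) * g a l) n a l =
    tS (fun n a l => II (e' n) a (l/2) * g a l) n a l := by
  induction n with
  | zero => intros; rfl
  | succ n ih =>
    intro a l hl h
    simp only [tS]
    rw [ih a (l/2) (by linarith), ih (a+l/2) (l/2) (by linarith), II_congr (φ := e n) (ψ := e' n)]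
    · intro x hx; exact h n (by omega) x ⟨hx.1, by linarith [hx.2]⟩
    · intro i hi x hx; exact h i (by omega) x ⟨by linarith [hx.1], by linarith [hx.2]⟩
    · intro i hi x hx; exact h i (by omega) x ⟨by linarith [hx.1], by linarith [hx.2]⟩

lemma lin (f : ℝ → ℝ≥0∞) (n : ℕ) : ∀ (a l : ℝ), 0 < l → ∀ W' : ℝ → ℝ≥0∞,
    Measurable W' → ∃ e : ℕ → ℝ → ℝ≥0∞, (∀ i, Measurable (e i)) ∧
    (∀ x, ∑ i ∈ Finset.range n, e i x ≤ W' x) ∧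
    II (fun x => Md f n a l x ^ p * W' x) a l ≤
    tS (fun n a l => II (e n) a (l/2) * (II f (a+l/2) (l/2) / ENNReal.ofReal (l/2))^p) n a l +
      II (fun x => 0 ^ p * W' x) a l := by
  induction n with
  | zero =>
    intro a l hl W' hW'
    exact ⟨fun _ _ => 0, fun _ => measurable_const, by simp, by simp [tS, Md]⟩
  | succ n ih =>
    intro a l hl W' hW'
    have hl2 : 0 < l/2 := by linarith
    set A := II f (a+l/2) (l/2) / ENNReal.ofReal (l/2) with hA
    set B : Set ℝ := {x | Md f n a (l/2) x ≤ A} with hB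
    have mB : MeasurableSet B := measurableSet_le (Md_meas f n _ _) measurable_const
    obtain ⟨e0, m0, s0, i0⟩ := ih a (l/2) hl2 (Bᶜ.indicator W') (hW'.indicator mB.compl)
    obtain ⟨e1, m1, s1, i1⟩ := ih (a+l/2) (l/2) hl2 W' hW'
    set e : ℕ → ℝ → ℝ≥0∞ := fun i x => if i = n then (if x < a+l/2 then B.indicator W' x else 0)
      else (if x < a+l/2 then e0 i x else e1 i x) with he
    refine ⟨e, ?_, ?_, ?_⟩
    · intro i
      by_cases hi : i = n
      · simp only [he, hi, if_true]
        exact Measurable.ite measurableSet_Iio (hW'.indicator mB) measurable_const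
      · simp only [he, hi, if_false]
        exact Measurable.ite measurableSet_Iio (m0 i) (m1 i)
    · intro x
      rw [Finset.sum_range_succ]
      by_cases hx : x < a + l/2
      · have : ∑ i ∈ Finset.range n, e i x = ∑ i ∈ Finset.range n, e0 i x := by
          refine Finset.sum_congr rfl fun i hi => ?_
          simp [he, hx, (Finset.mem_range.1 hi).ne]
        rw [this]
        simp only [he, if_true, hx]
        refine (add_le_add_left (s0 x) _).trans (le_of_eq ?_)
        by_cases hxB : x ∈ B <;> simp [hxB]
      · have : ∑ i ∈ Finset.range n, e i x = ∑ i ∈ Finset.range n, e1 i x := by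
          refine Finset.sum_congr rfl fun i hi => ?_
          simp [he, hx, (Finset.mem_range.1 hi).ne]
        rw [this]
        simp only [he, if_true, hx, if_false, add_zero]
        exact s1 x
    · simp only [tS]
      rw [II_split _ a l hl, II_split (fun x => 0^p * W' x) a l hl]
      rw [tS_congr _ e e0 n a (l/2) hl2, tS_congr _ e e1 n (a+l/2) (l/2) hl2]
      · have q0 : II (fun x => Md f (n+1) a l x ^ p * W' x) a (l/2) ≤
            II (e n) a (l/2) * A^p +
            II (fun x => Md f n a (l/2) x ^ p * Bᶜ.indicator W' x) a (l/2) := by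
          have mE : Measurable (fun x => B.indicator W' x * A^p) :=
            (hW'.indicator mB).mul_const _
          have : II (e n) a (l/2) * A^p = II (fun x => B.indicator W' x * A^p) a (l/2) := by
            have : II (e n) a (l/2) = II (B.indicator W') a (l/2) :=
              II_congr fun x hx => by simp [he, hx.2]
            rw [this]; unfold II
            rw [lintegral_mul_const _ (hW'.indicator mB)]
          rw [this, ← II_add mE]
          apply le_of_eq
          apply II_congr
          intro x hx
          simp only [Md, hx.2, if_true]
          by_cases hxB : x ∈ B
          · have : Md f n a (l/2) x ≤ A := hxB
            simp [hxB, ← hA, max_eq_left this, mul_comm]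
          · have : A ≤ Md f n a (l/2) x := (not_le.1 hxB).le
            simp [hxB, ← hA, max_eq_right this]
        have q1 : II (fun x => Md f (n+1) a l x ^ p * W' x) (a+l/2) (l/2) =
            II (fun x => Md f n (a+l/2) (l/2) x ^ p * W' x) (a+l/2) (l/2) :=
          II_congr fun x hx => by simp [Md, not_lt.2 hx.1]
        rw [q1]
        have z0 : II (fun x => 0 ^ p * Bᶜ.indicator W' x) a (l/2) ≤ II (fun x => 0 ^ p * W' x) a (l/2) :=
          II_mono (fun x => by gcongr; exact Set.indicator_le_self _ _ _) _ _
        refine (add_le_add (q0.trans (add_le_add_right (i0.trans (add_le_add_right z0 _)) _)) i1).trans (le_of_eq ?_)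
        ring
      · intro i hi x hx
        simp [he, hi.ne, not_lt.2 hx.1]
      · intro i hi x hx
        simp [he, hi.ne, hx.2]

lemma Good.Md_bound (h : Good p T W V) (f : ℝ → ℝ≥0∞) (hf : Measurable f)
    (n : ℕ) (a l : ℝ) (hl : 0 < l) :
    II (fun x => Md f n a l x ^ p * W x) a l ≤
      AA p T * KK p * II (fun x => f x ^ p * W x) a l := by
  have hp := h.hp
  obtain ⟨e, me, se, ie⟩ := lin (p := p) f n a l hl W h.mW
  have z : II (fun x => 0 ^ p * W x) a l = 0 := by
    simp [II, ENNReal.zero_rpow_of_pos (by linarith : 0 < p)]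
  rw [z, add_zero] at ie
  refine ie.trans ?_
  set e' : ℕ → ℝ → ℝ≥0∞ := fun i x => if i < n then e i x else 0 with he'
  rw [tS_congr _ e e' n a l hl (fun i hi x _ => by simp [he', hi])]
  refine h.strong e' ?_ ?_ f hf n a l hl
  · intro i
    by_cases hi : i < n
    · simp only [he', hi, if_true]; exact me i
    · simp only [he', hi, if_false]; exact measurable_const
  · intro m x
    refine le_trans ?_ (se x)
    simp only [he']
    rw [← Finset.sum_filter]
    refine Finset.sum_le_sum_of_subset ?_
    intro i hi
    simp at hi ⊢; exact hi.2

end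
open MeasureTheory Set Filter
open scoped ENNReal
noncomputable section
variable {p : ℝ} {T : ℝ≥0∞} {W V : ℝ → ℝ≥0∞}

/-- sup over depth -/
def MM (f : ℝ → ℝ≥0∞) (a l x : ℝ) : ℝ≥0∞ := ⨆ k, Md f k a l x

lemma Md_mono (f : ℝ → ℝ≥0∞) (k : ℕ) : ∀ a l x, Md f k a l x ≤ Md f (k+1) a l x := by
  induction k with
  | zero => intro a l x; simp [Md]
  | succ k ih =>
    intro a l x
    rw [Md, Md]
    split_ifs
    · exact max_le_max le_rfl (ih _ _ _)
    · exact ih _ _ _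

lemma chain (f : ℝ → ℝ≥0∞) (n : ℕ) : ∀ a l x, 0 < l → a ≤ x → x < a + l →
    ∫⁻ t in Ico (x + l/2^n) (a+l), f t ≤ ENNReal.ofReal l * Md f n a l x := by
  induction n with
  | zero =>
    intro a l x hl hx hx'
    rw [Ico_eq_empty]
    · simp
    · simp; linarith
  | succ n ih =>
    intro a l x hl hx hx'
    have hl2 : 0 < l/2 := by linarith
    have e : l / 2^(n+1) = (l/2)/2^n := by rw [pow_succ]; field_simp
    rw [e, Md]
    split_ifs with hc
    · have i := ih a (l/2) x hl2 hx hc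
      have hsub : Ico (x + l/2/2^n) (a+l) ⊆ Ico (x + l/2/2^n) (a+l/2) ∪ Ico (a+l/2) (a+l/2+l/2) := by
        intro t ht
        rcases lt_or_ge t (a+l/2) with h | h
        · left; exact ⟨ht.1, h⟩
        · right; exact ⟨h, by linarith [ht.2]⟩
      have h0 : ENNReal.ofReal (l/2) ≠ 0 := by simp [hl]
      have hl' : ENNReal.ofReal l = ENNReal.ofReal (l/2) + ENNReal.ofReal (l/2) := by
        rw [← ENNReal.ofReal_add hl2.le hl2.le]; congr 1; ring
      set A := II f (a+l/2) (l/2) / ENNReal.ofReal (l/2) with hA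
      have hAm : II f (a+l/2) (l/2) = ENNReal.ofReal (l/2) * A := by
        rw [hA, ENNReal.mul_div_cancel h0 (by simp)]
      calc _ ≤ _ := lintegral_mono_set hsub
        _ ≤ _ := lintegral_union_le _ _ _
        _ ≤ ENNReal.ofReal (l/2) * Md f n a (l/2) x + ENNReal.ofReal (l/2) * A :=
            add_le_add i hAm.le
        _ ≤ ENNReal.ofReal (l/2) * max A (Md f n a (l/2) x) + ENNReal.ofReal (l/2) * max A (Md f n a (l/2) x) := by
            gcongr
            · exact le_max_right _ _
            · exact le_max_left _ _
        _ = _ := by rw [hl']; ring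
    · have i := ih (a+l/2) (l/2) x hl2 (not_lt.1 hc) (by linarith)
      have : a + l/2 + l/2 = a + l := by ring
      rw [this] at i
      refine i.trans ?_
      gcongr
      linarith

lemma chain' (f : ℝ → ℝ≥0∞) (a l x : ℝ) (hl : 0 < l) (hx : a ≤ x) (hx' : x < a + l) :
    ∫⁻ t in Ioo x (a+l), f t ≤ ENNReal.ofReal l * MM f a l x := by
  have hU : Ioo x (a+l) = ⋃ n : ℕ, Ico (x + l/2^n) (a+l) := by
    ext t
    simp only [mem_Ioo, mem_iUnion, mem_Ico]
    constructor
    · rintro ⟨h1, h2⟩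
      obtain ⟨n, hn⟩ := exists_pow_lt_of_lt_one (show 0 < (t-x)/l from div_pos (by linarith) hl)
        (show (1/2:ℝ) < 1 by norm_num)
      refine ⟨n, ?_, h2⟩
      rw [lt_div_iff₀ hl, one_div, inv_pow, mul_comm, ← div_eq_mul_inv] at hn
      linarith
    · rintro ⟨n, h1, h2⟩
      have : 0 < l/2^n := by positivity
      exact ⟨by linarith, h2⟩
  rw [hU, setLIntegral_iUnion_of_directed]
  · refine iSup_le fun n => (chain f n a l x hl hx hx').trans ?_
    gcongr
    exact le_iSup (fun k => Md f k a l x) n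
  · refine Monotone.directed_le ?_
    intro m n hmn
    refine Ico_subset_Ico_left ?_
    gcongr
    norm_num

lemma MM_left (f : ℝ → ℝ≥0∞) (a l x : ℝ) (hx : x < a + l/2) : MM f a (l/2) x ≤ MM f a l x := by
  refine iSup_le fun k => le_trans ?_ (le_iSup _ (k+1))
  simp [Md, hx]

lemma MM_right (f : ℝ → ℝ≥0∞) (a l x : ℝ) (hx : a + l/2 ≤ x) : MM f (a+l/2) (l/2) x ≤ MM f a l x := by
  refine iSup_le fun k => le_trans ?_ (le_iSup _ (k+1))
  simp [Md, not_lt.2 hx]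

lemma dom (f : ℝ → ℝ≥0∞) (n : ℕ) : ∀ a l x y : ℝ, 0 < l → a ≤ x → x < y → y < a + l →
    l < 2^n * (y-x) → ∃ m : ℕ, ∃ j : ℤ, x < a + l*j/2^m ∧ a + l*j/2^m ≤ y ∧
      ∫⁻ t in Ioo x y, f t ≤ ENNReal.ofReal (2*l/2^m) * MM f a l x := by
  induction n with
  | zero => intro a l x y _ _ _ _ h; simp at h; linarith
  | succ n ih =>
    intro a l x y hl hx hxy hy hn
    have hl2 : 0 < l/2 := by linarith
    rcases lt_or_ge y (a+l/2) with h1 | h1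
    · obtain ⟨m, j, c1, c2, c3⟩ := ih a (l/2) x y hl2 hx hxy h1 (by rw [pow_succ] at hn; linarith)
      have e : l*j/2^(m+1) = l/2*j/2^m := by rw [pow_succ]; field_simp
      have e2 : 2*l/2^(m+1) = 2*(l/2)/2^m := by rw [pow_succ]; field_simp
      refine ⟨m+1, j, by rw [e]; exact c1, by rw [e]; exact c2, ?_⟩
      rw [e2]
      refine c3.trans ?_
      gcongr
      exact MM_left f a l x (by linarith)
    rcases lt_or_ge x (a+l/2) with h2 | h2
    · refine ⟨1, 1, by simpa using h2, by simpa using h1, ?_⟩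
      have : 2*l/2^1 = l := by ring
      rw [this]
      exact (lintegral_mono_set (Ioo_subset_Ioo_right hy.le)).trans (chain' f a l x hl hx (by linarith))
    · obtain ⟨m, j, c1, c2, c3⟩ := ih (a+l/2) (l/2) x y hl2 h2 hxy (by linarith) (by rw [pow_succ] at hn; linarith)
      have e : a + l*((2^m + j : ℤ):ℝ)/2^(m+1) = a + l/2 + l/2*j/2^m := by
        push_cast; rw [pow_succ]; field_simp; ring
      have e2 : 2*l/2^(m+1) = 2*(l/2)/2^m := by rw [pow_succ]; field_simp
      refine ⟨m+1, 2^m + j, by rw [e]; exact c1, by rw [e]; exact c2, ?_⟩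
      rw [e2]
      refine c3.trans ?_
      gcongr
      exact MM_right f a l x h2

lemma third (f : ℝ → ℝ≥0∞) (a l x y : ℝ) (hl : 0 < l) (hx : a + l/3 ≤ x) (hxy : x < y) (hy : y < a + l) :
    ∫⁻ t in Ioo x y, f t ≤ ENNReal.ofReal (6*(y-x)) * max (MM f a l x) (MM f (a+l/3) l x) := by
  obtain ⟨n, hn⟩ := pow_unbounded_of_one_lt (l/(y-x)) (show (1:ℝ) < 2 by norm_num)
  rw [div_lt_iff₀ (by linarith)] at hn
  obtain ⟨m, j, c1, c2, c3⟩ := dom f n a l x y hl (by linarith) hxy hy hn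
  obtain ⟨m', j', d1, d2, d3⟩ := dom f n (a+l/3) l x y hl hx hxy (by linarith) hn
  rcases le_or_gt (2*l/2^m) (6*(y-x)) with h | h
  · refine c3.trans ?_
    gcongr
    exact le_max_left _ _
  rcases le_or_gt (2*l/2^m') (6*(y-x)) with h' | h'
  · refine d3.trans ?_
    gcongr
    exact le_max_right _ _
  exfalso
  obtain ⟨M, u, u', hM, hM', hMM⟩ : ∃ M u u' : ℕ, M = m + u ∧ M = m' + u' ∧ (M = m ∨ M = m') := by
    rcases le_total m m' with h | h
    · exact ⟨m', m'-m, 0, by omega, by omega, Or.inr rfl⟩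
    · exact ⟨m, 0, m-m', by omega, by omega, Or.inl rfl⟩
  have hMl : 3*(y-x) < l/2^M := by
    rcases hMM with h1 | h1 <;> rw [h1]
    · have : 2*l/2^m = 2*(l/2^m) := by ring
      linarith
    · have : 2*l/2^m' = 2*(l/2^m') := by ring
      linarith
  have ec : l*j/2^m = l/2^M * (j*2^u) := by rw [hM, pow_add]; field_simp
  have ed : l*j'/2^m' = l/2^M * (j'*2^u') := by rw [hM', pow_add]; field_simp
  have el : l/3 = l/2^M * (2^M/3) := by field_simp
  set δ := l/2^M with hδ
  have hδ0 : 0 < δ := by positivity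
  rw [ec] at c1 c2
  rw [ed, el] at d1 d2
  set z : ℤ := 3*(j*2^u - j'*2^u') - 2^M with hz
  have hzr : (z:ℝ) = 3*(j*2^u - j'*2^u') - 2^M := by rw [hz]; push_cast; ring
  have hzδ : δ * z = 3 * (δ*(j*2^u) - δ*(2^M/3) - δ*(j'*2^u')) := by rw [hzr]; ring
  have z1 : δ * z < δ * 1 := by rw [hzδ]; linarith
  have z2 : δ * (-1) < δ * z := by rw [hzδ]; linarith
  have z1' : (z:ℝ) < 1 := lt_of_mul_lt_mul_left z1 hδ0.le
  have z2' : (-1:ℝ) < z := lt_of_mul_lt_mul_left z2 hδ0.le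
  have z3 : z < 1 := by exact_mod_cast z1'
  have z4 : -1 < z := by exact_mod_cast z2'
  have z0 : z = 0 := by omega
  have hdvd : (3:ℤ) ∣ 2^M := ⟨j*2^u - j'*2^u', by rw [z0] at hz; linarith⟩
  have := Int.prime_three.dvd_of_dvd_pow hdvd
  omega

/-- maximal function of an extended nonnegative function -/
def Mp (F : ℝ → ℝ≥0∞) (x : ℝ) : ℝ≥0∞ :=
  ⨆ (h : ℝ) (_ : 0 < h), (ENNReal.ofReal h)⁻¹ * ∫⁻ t in Set.Ioc x (x + h), F t

lemma MM_meas (f : ℝ → ℝ≥0∞) (a l : ℝ) : Measurable (MM f a l) :=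
  Measurable.iSup fun k => Md_meas f k a l

lemma Good.MM_bound (h : Good p T W V) (f : ℝ → ℝ≥0∞) (hf : Measurable f) (a l : ℝ) (hl : 0 < l) :
    II (fun x => MM f a l x ^ p * W x) a l ≤ AA p T * KK p * ∫⁻ x, f x ^ p * W x := by
  have hp : 0 < p := by linarith [h.hp]
  have e : ∀ x, MM f a l x ^ p * W x = ⨆ k, Md f k a l x ^ p * W x := by
    intro x
    rw [← ENNReal.iSup_mul]
    congr 1
    exact (ENNReal.orderIsoRpow p hp).map_iSup _
  unfold II
  simp_rw [e]
  rw [lintegral_iSup]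
  · refine iSup_le fun k => (h.Md_bound f hf k a l hl).trans ?_
    gcongr
    exact setLIntegral_le_lintegral _ _
  · intro k
    exact ((Md_meas f k a l).pow_const p).mul h.mW
  · refine monotone_nat_of_le_succ fun k x => ?_
    have := Md_mono f k a l x
    dsimp only
    gcongr

lemma Good.core (h : Good p T W V) (f : ℝ → ℝ≥0∞) (hf : Measurable f) :
    ∫⁻ x, Mp f x ^ p * W x ≤ 6^p * (2 * (AA p T * KK p)) * ∫⁻ x, f x ^ p * W x := by
  have hp : 0 < p := by linarith [h.hp]
  set D : ℕ → ℝ → ℝ → ℝ≥0∞ := fun N a => (Ico a (a+6*(N+1))).indicator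
    (fun x => MM f a (6*(N+1)) x ^ p * W x) with hD
  have mD : ∀ N a, Measurable (D N a) := fun N a =>
    (((MM_meas f _ _).pow_const p).mul h.mW).indicator measurableSet_Ico
  set g : ℕ → ℝ → ℝ≥0∞ := fun N x => 6^p * (D N (-3*(N+1)) x + D N (-3*(N+1) + 6*(N+1)/3) x) with hg
  have mg : ∀ N, Measurable (g N) := fun N => ((mD N _).add (mD N _)).const_mul _
  have iD : ∀ N a, ∫⁻ x, D N a x ≤ AA p T * KK p * ∫⁻ x, f x ^ p * W x := by
    intro N a
    rw [hD]
    simp only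
    rw [lintegral_indicator measurableSet_Ico]
    exact h.MM_bound f hf a (6*(N+1)) (by positivity)
  have ig : ∀ N, ∫⁻ x, g N x ≤ 6^p * (2 * (AA p T * KK p)) * ∫⁻ x, f x ^ p * W x := by
    intro N
    simp only [hg]
    rw [lintegral_const_mul' _ _ (ENNReal.rpow_ne_top_of_nonneg hp.le (by simp)), lintegral_add_left (mD N _)]
    calc _ ≤ 6^p * ((AA p T * KK p * ∫⁻ x, f x ^ p * W x) + (AA p T * KK p * ∫⁻ x, f x ^ p * W x)) := by
          gcongr <;> apply iD
      _ = _ := by ring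
  have pt : ∀ x, Mp f x ^ p * W x ≤ liminf (fun N => g N x) atTop := by
    intro x
    have hW0 := h.W0 x
    have hWt := h.Wt x
    rw [← ENNReal.le_div_iff_mul_le (Or.inl hW0) (Or.inl hWt), ← ENNReal.le_rpow_inv_iff hp]
    refine iSup_le fun s => iSup_le fun hs => ?_
    rw [ENNReal.le_rpow_inv_iff hp, ENNReal.le_div_iff_mul_le (Or.inl hW0) (Or.inl hWt)]
    refine le_liminf_of_le (by isBoundedDefault) ?_
    obtain ⟨N0, hN0⟩ := exists_nat_gt (|x| + s)
    filter_upwards [eventually_ge_atTop N0] with N hN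
    have hN' : |x| + s < N := lt_of_lt_of_le hN0 (by exact_mod_cast hN)
    have hx1 := neg_abs_le x
    have hx2 := le_abs_self x
    have key := third f (-3*(N+1)) (6*(N+1)) x (x+s) (by positivity) (by linarith) (by linarith) (by linarith)
    rw [setLIntegral_congr Ioo_ae_eq_Ioc] at key
    have hs6 : ENNReal.ofReal (6*(x+s-x)) = ENNReal.ofReal s * 6 := by
      rw [add_sub_cancel_left, mul_comm, ENNReal.ofReal_mul hs.le]; simp
    rw [hs6, mul_assoc] at key
    have k2 : (ENNReal.ofReal s)⁻¹ * ∫⁻ t in Ioc x (x+s), f t ≤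
        6 * max (MM f (-3*(N+1)) (6*(N+1)) x) (MM f (-3*(N+1) + 6*(N+1)/3) (6*(N+1)) x) := by
      rw [ENNReal.inv_mul_le_iff (by simp [hs]) (by simp)]
      exact key
    have x1 : x ∈ Ico (-3*((N:ℝ)+1)) (-3*(N+1) + 6*(N+1)) := ⟨by linarith, by linarith⟩
    have x2 : x ∈ Ico (-3*((N:ℝ)+1) + 6*(N+1)/3) (-3*(N+1) + 6*(N+1)/3 + 6*(N+1)) :=
      ⟨by linarith, by linarith⟩
    simp only [hg, hD]
    rw [indicator_of_mem x1, indicator_of_mem x2]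
    refine (mul_le_mul_left (ENNReal.rpow_le_rpow k2 hp.le) _).trans ?_
    rw [ENNReal.mul_rpow_of_nonneg _ _ hp.le, mul_assoc, ← add_mul]
    gcongr
    rcases max_choice (MM f (-3*(N+1)) (6*(N+1)) x) (MM f (-3*(N+1) + 6*(N+1)/3) (6*(N+1)) x) with hh | hh <;> rw [hh]
    · exact le_self_add
    · exact le_add_self
  calc _ ≤ ∫⁻ x, liminf (fun N => g N x) atTop := lintegral_mono pt
    _ ≤ liminf (fun N => ∫⁻ x, g N x) atTop := lintegral_liminf_le mg
    _ ≤ _ := liminf_le_of_le (by isBoundedDefault) (fun b hb => by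
        obtain ⟨N, hN⟩ := hb.exists
        exact hN.trans (ig N))

end
open MeasureTheory Set Filter
open scoped ENNReal
noncomputable section
variable {p : ℝ} {T : ℝ≥0∞} {W V : ℝ → ℝ≥0∞}

lemma minorant (F : ℝ → ℝ≥0∞) : ∃ g : ℝ → ℝ≥0∞, Measurable g ∧ (∀ x, g x ≤ F x) ∧
    ∀ x, Mp F x ≤ Mp g x := by
  choose k mk lek ek using fun q : ℚ × ℚ =>
    exists_measurable_le_lintegral_eq (volume.restrict (Ioc (q.1:ℝ) (q.2:ℝ))) F
  refine ⟨fun x => ⨆ q, k q x, Measurable.iSup mk, fun x => iSup_le fun q => lek q x, fun x => ?_⟩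
  refine iSup_mono fun h => iSup_mono fun hh => ?_
  gcongr 1
  rw [← setLIntegral_congr Ioo_ae_eq_Ioc, ← setLIntegral_congr Ioo_ae_eq_Ioc]
  have hU : Ioo x (x+h) = ⋃ q : {q : ℚ × ℚ // x < q.1 ∧ (q.2:ℝ) < x + h},
      Ioc (q.1.1:ℝ) (q.1.2:ℝ) := by
    ext t
    simp only [mem_Ioo, mem_iUnion, mem_Ioc]
    constructor
    · rintro ⟨h1, h2⟩
      obtain ⟨a, ha1, ha2⟩ := exists_rat_btwn h1
      obtain ⟨b, hb1, hb2⟩ := exists_rat_btwn h2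
      exact ⟨⟨(a,b), ha1, hb2⟩, ha2, hb1.le⟩
    · rintro ⟨⟨q, h1, h2⟩, h3, h4⟩
      exact ⟨h1.trans h3, h4.trans_lt h2⟩
  have hd : Directed (· ⊆ ·) (fun q : {q : ℚ × ℚ // x < q.1 ∧ (q.2:ℝ) < x + h} =>
      Ioc (q.1.1:ℝ) (q.1.2:ℝ)) := by
    rintro ⟨q, hq1, hq2⟩ ⟨r, hr1, hr2⟩
    refine ⟨⟨(min q.1 r.1, max q.2 r.2), ?_, ?_⟩, ?_, ?_⟩
    · push_cast; exact lt_min hq1 hr1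
    · push_cast; exact max_lt hq2 hr2
    · apply Ioc_subset_Ioc <;> push_cast <;> simp
    · apply Ioc_subset_Ioc <;> push_cast <;> simp
  rw [hU, setLIntegral_iUnion_of_directed _ hd, ← hU]
  refine iSup_le fun q => ?_
  rw [ek q.1]
  refine le_trans (lintegral_mono fun t => le_iSup (fun q => k q t) q.1) ?_
  refine lintegral_mono_set ?_
  rw [hU]
  exact subset_iUnion (fun q : {q : ℚ × ℚ // x < q.1 ∧ (q.2:ℝ) < x + h} =>
      Ioc (q.1.1:ℝ) (q.1.2:ℝ)) q

lemma good_of_weight (hp : 1 < p) (w : ℝ → ℝ) (hw : IsWeight w) (hT : apPlusChar p w ≠ ∞) :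
    ∃ W V : ℝ → ℝ≥0∞, Good p (apPlusChar p w) W V ∧ W =ᵐ[volume] fun x => ENNReal.ofReal (w x) := by
  have hp1 : 0 < p - 1 := by linarith
  obtain ⟨hpos, hloc⟩ := hw
  have hm : AEMeasurable (fun x => ENNReal.ofReal (w x)) volume :=
    hloc.aestronglyMeasurable.aemeasurable.ennreal_ofReal
  set W0 := hm.mk with hW0
  have mW0 : Measurable W0 := hm.measurable_mk
  set W : ℝ → ℝ≥0∞ := fun x => if W0 x = 0 ∨ W0 x = ⊤ then 1 else W0 x with hWdef
  have mW : Measurable W := Measurable.ite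
    ((mW0 (measurableSet_singleton 0)).union (mW0 (measurableSet_singleton ⊤))) measurable_const mW0
  have W0' : ∀ x, W x ≠ 0 := by
    intro x; simp only [hWdef]; split_ifs with h
    · simp
    · exact fun h' => h (Or.inl h')
  have Wt' : ∀ x, W x ≠ ⊤ := by
    intro x; simp only [hWdef]; split_ifs with h
    · simp
    · exact fun h' => h (Or.inr h')
  have hWw : W =ᵐ[volume] fun x => ENNReal.ofReal (w x) := by
    filter_upwards [hm.ae_eq_mk, hpos] with x hx hx'
    have : W0 x = ENNReal.ofReal (w x) := hx.symm
    simp [hWdef, this, hx']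
  set V : ℝ → ℝ≥0∞ := fun x => W x ^ (-(1/(p-1))) with hV
  have hVw : V =ᵐ[volume] fun x => ENNReal.ofReal (w x ^ (1 - p/(p-1))) := by
    filter_upwards [hWw, hpos] with x hx hx'
    simp only [hV]
    rw [hx, ENNReal.ofReal_rpow_of_pos hx']
    congr 2
    field_simp; ring
  have iW : ∀ a l, II W a l = lintIoc w a (a+l) := by
    intro a l
    unfold II lintIoc
    rw [setLIntegral_congr Ico_ae_eq_Ioc]
    exact lintegral_congr_ae (ae_restrict_of_ae hWw)
  have iV : ∀ a l, II V a l = lintIoc (fun t => w t ^ (1 - p/(p-1))) a (a+l) := by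
    intro a l
    unfold II lintIoc
    rw [setLIntegral_congr Ico_ae_eq_Ioc]
    exact lintegral_congr_ae (ae_restrict_of_ae hVw)
  refine ⟨W, V, ⟨hp, mW, mW.pow_const _, W0', Wt', fun x => rfl, ?_, hT, ?_⟩, hWw⟩
  · intro a l
    rw [iW]
    have : IntegrableOn w (Ioc a (a+l)) :=
      (hloc.integrableOn_isCompact isCompact_Icc).mono_set Ioc_subset_Icc_self
    exact this.lintegral_lt_top.ne
  · intro a l hl
    have h1 : avgIoc w (a+l-l) (a+l) *
      avgIoc (fun t => w t ^ (1 - p / (p - 1))) (a+l) (a+l+l) ^ (p - 1) ≤ apPlusChar p w :=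
      le_iSup_of_le (a+l) (le_iSup_of_le l (le_iSup_of_le hl le_rfl))
    unfold avgIoc at h1
    rw [add_sub_cancel_right, ← iW, ← iV, add_sub_cancel_left, add_sub_cancel_left] at h1
    set L := ENNReal.ofReal l with hL
    have hL0 : L ≠ 0 := by simp [hL, hl]
    have hLt : L ≠ ⊤ := by simp [hL]
    rw [ENNReal.mul_rpow_of_nonneg _ _ hp1.le] at h1
    have e : L^p = L * L^(p-1) := by
      nth_rewrite 2 [← ENNReal.rpow_one L]
      rw [← ENNReal.rpow_add _ _ hL0 hLt]; congr 1; ring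
    have e1 := ENNReal.mul_inv_cancel hL0 hLt
    have e2 : L^(p-1) * (L⁻¹)^(p-1) = 1 := by
      rw [← ENNReal.mul_rpow_of_nonneg _ _ hp1.le, e1, ENNReal.one_rpow]
    calc _ = (L * L⁻¹) * (L^(p-1) * (L⁻¹)^(p-1)) * (II W a l * II V (a+l) l ^ (p-1)) := by
          rw [e1, e2]; simp
      _ = (L⁻¹ * II W a l * ((L⁻¹)^(p-1) * II V (a+l) l ^ (p-1))) * (L * L^(p-1)) := by ring
      _ ≤ apPlusChar p w * L^p := by rw [e]; gcongr

theorem stmt0 (p : ℝ) (hp : 1 < p) :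
    ∃ c : ℝ, 0 < c ∧
      ∀ w : ℝ → ℝ, IsWeight w → apPlusChar p w ≠ ∞ →
        ∀ f : ℝ → ℝ,
          lnormW p w (Mplus f) ≤
            ENNReal.ofReal c * apPlusChar p w ^ (1 / (p - 1)) *
              lnormW p w (fun x => ENNReal.ofReal |f x|) := by
  have hp1 : 0 < p - 1 := by linarith
  have hp0 : 0 < p := by linarith
  set C : ℝ≥0∞ := (6^p * (2 * ((KK (p/(p-1)) + 1) * KK p)))^(1/p) with hC
  have hCt : C ≠ ⊤ := by
    refine ENNReal.rpow_ne_top_of_nonneg (by positivity) ?_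
    refine ENNReal.mul_ne_top (ENNReal.rpow_ne_top_of_nonneg hp0.le (by simp)) ?_
    refine ENNReal.mul_ne_top (by simp) (ENNReal.mul_ne_top ?_ ?_)
    · simp [KK]
    · simp [KK]
  refine ⟨C.toReal + 1, by positivity, ?_⟩
  intro w hw hT f
  obtain ⟨W, V, hG, hWw⟩ := good_of_weight hp w hw hT
  obtain ⟨g, mg, gle, hM⟩ := minorant (fun x => ENNReal.ofReal |f x|)
  have hMf : ∀ x, Mplus f x = Mp (fun x => ENNReal.ofReal |f x|) x := fun x => rfl
  have hCle : C ≤ ENNReal.ofReal (C.toReal + 1) := by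
    rw [← ENNReal.ofReal_toReal hCt]
    exact ENNReal.ofReal_le_ofReal (by simp)
  set T := apPlusChar p w
  have h1 : ∫⁻ x, Mplus f x ^ p * ENNReal.ofReal (w x) ≤
      6^p * (2 * (AA p T * KK p)) * ∫⁻ x, ENNReal.ofReal |f x| ^ p * ENNReal.ofReal (w x) := by
    calc _ = ∫⁻ x, Mplus f x ^ p * W x := lintegral_congr_ae (by
            filter_upwards [hWw] with x hx; rw [hx])
      _ ≤ ∫⁻ x, Mp g x ^ p * W x := lintegral_mono fun x => by
            have := hM x
            rw [← hMf] at this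
            dsimp only
            gcongr
      _ ≤ _ := hG.core g mg
      _ ≤ 6^p * (2 * (AA p T * KK p)) * ∫⁻ x, ENNReal.ofReal |f x| ^ p * W x := by
            gcongr with x
            exact gle x
      _ = _ := by
            congr 1
            exact lintegral_congr_ae (by filter_upwards [hWw] with x hx; rw [hx])
  unfold lnormW
  refine (ENNReal.rpow_le_rpow h1 (z := 1/p) (by positivity)).trans ?_
  have e : 6^p * (2 * (AA p T * KK p)) = (6^p * (2 * ((KK (p/(p-1)) + 1) * KK p))) * T^(p/(p-1)) := by
    unfold AA; ring
  rw [ENNReal.mul_rpow_of_nonneg _ _ (by positivity), e, ENNReal.mul_rpow_of_nonneg _ _ (by positivity),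
    ← hC, ← ENNReal.rpow_mul]
  have e2 : p/(p-1) * (1/p) = 1/(p-1) := by field_simp
  rw [e2]
  gcongr

end
end

section
/- Let 0<α<1, 1<p<1/α, and let q satisfy 1/q = 1/p − α. There exists a constant c depending only on p and α such that for every weight w on ℝ: [w^q, w^p]^-_{Glo}(p,q) ≤ c ‖w‖_{A_{p,q}^-(ℝ)}^{1-α}, and likewise [w^q, w^p]^+_{Glo}(p,q) ≤ c ‖w‖_{A_{p,q}^+(ℝ)}^{1-α}. -/
open MeasureTheory Set Filter
open scoped ENNReal

noncomputable section
open MeasureTheory Set Filter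
open scoped ENNReal

noncomputable section

/-- The one-sided `A_{p,q}^-` characteristic:
`sup_{x,h>0} ((1/h)∫_x^{x+h} u^q)((1/h)∫_{x-h}^x u^{-p'})^{q/p'}`, `p' = p/(p-1)`. -/
def apqMinusChar (p q : ℝ) (u : ℝ → ℝ) : ℝ≥0∞ :=
  ⨆ (x : ℝ) (h : ℝ) (_ : 0 < h),
    avgIoc (fun t => u t ^ q) x (x + h) *
      avgIoc (fun t => u t ^ (-(p / (p - 1)))) (x - h) x ^ (q / (p / (p - 1)))

/-- The one-sided `A_{p,q}^+` characteristic: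
`sup_{x,h>0} ((1/h)∫_{x-h}^x u^q)((1/h)∫_x^{x+h} u^{-p'})^{q/p'}`, `p' = p/(p-1)`. -/
def apqPlusChar (p q : ℝ) (u : ℝ → ℝ) : ℝ≥0∞ :=
  ⨆ (x : ℝ) (h : ℝ) (_ : 0 < h),
    avgIoc (fun t => u t ^ q) (x - h) x *
      avgIoc (fun t => u t ^ (-(p / (p - 1)))) x (x + h) ^ (q / (p / (p - 1)))


/-- The Gabidzashvili–Kokilashvili quantity
`[v,w]⁻_{Glo}(p,q) = sup_{a,h>0} (∫_{a-h}^{a+h} v)^{1/q}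
  (∫_{-∞}^{a-h} (a-t)^{(α-1)p'} w(t)^{1-p'} dt)^{1/p'}`, `p' = p/(p-1)`. -/
def gloMinus (α p q : ℝ) (v w : ℝ → ℝ) : ℝ≥0∞ :=
  ⨆ (a : ℝ) (h : ℝ) (_ : 0 < h),
    (∫⁻ t in Set.Ioc (a - h) (a + h), ENNReal.ofReal (v t)) ^ (1 / q) *
      (∫⁻ t in Set.Iio (a - h),
          ENNReal.ofReal ((a - t) ^ ((α - 1) * (p / (p - 1))) *
            w t ^ (1 - p / (p - 1)))) ^ (1 - 1 / p)

/-- The Gabidzashvili–Kokilashvili quantity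
`[v,w]⁺_{Glo}(p,q) = sup_{a,h>0} (∫_{a-h}^{a+h} v)^{1/q}
  (∫_{a+h}^{∞} (t-a)^{(α-1)p'} w(t)^{1-p'} dt)^{1/p'}`, `p' = p/(p-1)`. -/
def gloPlus (α p q : ℝ) (v w : ℝ → ℝ) : ℝ≥0∞ :=
  ⨆ (a : ℝ) (h : ℝ) (_ : 0 < h),
    (∫⁻ t in Set.Ioc (a - h) (a + h), ENNReal.ofReal (v t)) ^ (1 / q) *
      (∫⁻ t in Set.Ioi (a + h),
          ENNReal.ofReal ((t - a) ^ ((α - 1) * (p / (p - 1))) *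
            w t ^ (1 - p / (p - 1)))) ^ (1 - 1 / p)

theorem glo_geom (τ K A : ℝ) (hτ : 0 < τ) (hK : 0 < K) (hA : 0 < A) (hKA : 1 ≤ K * A) :
    (1 + 1 / (K * A)) ^ (-τ) < 1 ∧
      (1 - (1 + 1 / (K * A)) ^ (-τ))⁻¹ ≤ 2 * K / min 1 τ * A := by
  have hB : 0 < K * A := by positivity
  set B := K * A with hBdef
  have hx0 : 0 < 1 / (1 + B) := by positivity
  have hx1 : 1 / (1 + B) < 1 := by
    rw [div_lt_one (by positivity)]; linarith
  have hm : 0 < min 1 τ := lt_min one_pos hτ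
  have e1 : (1 + 1 / B) ^ (-τ) = (1 + -(1 / (1 + B))) ^ τ := by
    rw [Real.rpow_neg (by positivity), ← Real.inv_rpow (by positivity)]
    congr 1
    field_simp
    ring
  have e2 : (1 + -(1 / (1 + B))) ^ τ ≤ (1 + -(1 / (1 + B))) ^ (min 1 τ) :=
    Real.rpow_le_rpow_of_exponent_ge (by linarith) (by linarith) (min_le_right _ _)
  have e3 : (1 + -(1 / (1 + B))) ^ (min 1 τ) ≤ 1 + min 1 τ * -(1 / (1 + B)) :=
    rpow_one_add_le_one_add_mul_self (by linarith) hm.le (min_le_left _ _)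
  have e4 : min 1 τ * (1 / (1 + B)) ≤ 1 - (1 + 1 / B) ^ (-τ) := by
    rw [e1]; linarith
  have e5 : 0 < min 1 τ * (1 / (1 + B)) := by positivity
  refine ⟨by linarith, ?_⟩
  calc (1 - (1 + 1 / B) ^ (-τ))⁻¹ ≤ (min 1 τ * (1 / (1 + B)))⁻¹ := by
        gcongr
    _ = (1 + B) / min 1 τ := by field_simp
    _ ≤ (2 * B) / min 1 τ := by gcongr; linarith
    _ = 2 * K / min 1 τ * A := by rw [hBdef]; ring

theorem glo_core (q s r : ℝ) (hq : 0 < q) (hs : 0 < s) (hr : r = q / s)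
    (μ ν : Measure ℝ) (A : ℝ) (hA : 0 ≤ A)
    (H1 : ∀ x h : ℝ, 0 < h → μ (Ioc x (x + h)) * ν (Ioc (x - h) x) ^ r ≤
      ENNReal.ofReal (A * h ^ (1 + r)))
    (H2 : ∀ x h : ℝ, 0 < h → ENNReal.ofReal (h ^ (1 + r)) ≤
      μ (Ioc x (x + h)) * ν (Ioc x (x + h)) ^ r)
    (a h : ℝ) (hh : 0 < h) :
    μ (Ioc (a - h) (a + h)) ^ (1 / q) *
      (∫⁻ t in Iio (a - h), ENNReal.ofReal ((a - t) ^ (-(1 + 1 / r))) ∂ν) ^ (1 / s) ≤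
    ENNReal.ofReal ((2 ^ (1 + 1 / r) * (2 * 2 ^ (1 + r) / min 1 (1 / r))) ^ (1 / s)) *
      ENNReal.ofReal (A ^ (1 / q + 1 / s)) := by
  have hr0 : 0 < r := by rw [hr]; positivity
  have μ0 : ∀ x h : ℝ, 0 < h → μ (Ioc x (x + h)) ≠ 0 := by
    intro x h hh h0
    have := H2 x h hh
    rw [h0, zero_mul, nonpos_iff_eq_zero, ENNReal.ofReal_eq_zero] at this
    have : 0 < h ^ (1 + r) := by positivity
    linarith
  have ν0 : ∀ x h : ℝ, 0 < h → ν (Ioc x (x + h)) ≠ 0 := by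
    intro x h hh h0
    have := H2 x h hh
    rw [h0, ENNReal.zero_rpow_of_pos hr0, mul_zero, nonpos_iff_eq_zero,
      ENNReal.ofReal_eq_zero] at this
    have : 0 < h ^ (1 + r) := by positivity
    linarith
  have ν0' : ∀ x h : ℝ, 0 < h → ν (Ioc (x - h) x) ≠ 0 := by
    intro x h hh
    have := ν0 (x - h) h hh
    rwa [sub_add_cancel] at this
  have μt : ∀ x h : ℝ, 0 < h → μ (Ioc x (x + h)) ≠ ⊤ := by
    intro x h hh ht
    have := H1 x h hh
    rw [ht, ENNReal.top_mul] at this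
    · exact ENNReal.ofReal_ne_top (top_le_iff.1 this)
    · rw [Ne, ENNReal.rpow_eq_zero_iff]
      have := ν0' x h hh
      rintro (⟨h1, -⟩ | ⟨-, h2⟩)
      · exact this h1
      · linarith
  have νt : ∀ x h : ℝ, 0 < h → ν (Ioc (x - h) x) ≠ ⊤ := by
    intro x h hh ht
    have := H1 x h hh
    rw [ht, ENNReal.top_rpow_of_pos hr0, ENNReal.mul_top (μ0 x h hh)] at this
    exact ENNReal.ofReal_ne_top (top_le_iff.1 this)
  have μt' : ∀ x y : ℝ, μ (Ioc x y) ≠ ⊤ := by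
    intro x y
    rcases lt_or_ge x y with hxy | hxy
    · have := μt x (y - x) (by linarith)
      rwa [add_sub_cancel] at this
    · simp [Ioc_eq_empty (not_lt.2 hxy)]
  have νt' : ∀ x y : ℝ, ν (Ioc x y) ≠ ⊤ := by
    intro x y
    rcases lt_or_ge x y with hxy | hxy
    · have := νt y (y - x) (by linarith)
      rwa [sub_sub_cancel] at this
    · simp [Ioc_eq_empty (not_lt.2 hxy)]
  have μpos : ∀ x y : ℝ, x < y → 0 < μ.real (Ioc x y) := by
    intro x y hxy
    have := μ0 x (y - x) (by linarith)
    rw [add_sub_cancel] at this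
    exact ENNReal.toReal_pos this (μt' _ _)
  have νpos : ∀ x y : ℝ, x < y → 0 < ν.real (Ioc x y) := by
    intro x y hxy
    have := ν0 x (y - x) (by linarith)
    rw [add_sub_cancel] at this
    exact ENNReal.toReal_pos this (νt' _ _)
  have R1 : ∀ a H : ℝ, 0 < H → μ.real (Ioc (a - H) (a + H)) * ν.real (Ioc (a - 2 * H) (a - H)) ^ r
      ≤ A * (2 ^ (1 + r) * H ^ (1 + r)) := by
    intro a H hH
    have h1 := H1 (a - H) (2 * H) (by positivity)
    have h2 := ENNReal.toReal_mono ENNReal.ofReal_ne_top h1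
    rw [ENNReal.toReal_ofReal (by positivity), ENNReal.toReal_mul, ← ENNReal.toReal_rpow,
      show a - H + 2 * H = a + H by ring, Real.mul_rpow (by norm_num) hH.le] at h2
    refine le_trans ?_ h2
    have h3 : ν.real (Ioc (a - 2 * H) (a - H)) ≤ ν.real (Ioc (a - H - 2 * H) (a - H)) :=
      measureReal_mono (Ioc_subset_Ioc_left (by linarith)) (νt' _ _)
    have := Real.rpow_le_rpow measureReal_nonneg h3 hr0.le
    exact mul_le_mul_of_nonneg_left this measureReal_nonneg
  have R2 : ∀ a H : ℝ, 0 < H → H ^ (1 + r) ≤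
      μ.real (Ioc (a - 2 * H) (a - H)) * ν.real (Ioc (a - 2 * H) (a - H)) ^ r := by
    intro a H hH
    have h1 := H2 (a - 2 * H) H hH
    rw [show a - 2 * H + H = a - H by ring] at h1
    have h2 := ENNReal.toReal_mono (ENNReal.mul_ne_top (μt' _ _)
      (ENNReal.rpow_ne_top_of_nonneg hr0.le (νt' _ _))) h1
    rwa [ENNReal.toReal_ofReal (by positivity), ENNReal.toReal_mul, ← ENNReal.toReal_rpow] at h2
  obtain ⟨K, hKd⟩ : ∃ K : ℝ, K = 2 ^ (1 + r) := ⟨_, rfl⟩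
  rw [← hKd] at R1 ⊢
  have hK : 0 < K := by rw [hKd]; positivity
  have D : ∀ a H : ℝ, 0 < H → μ.real (Ioc (a - H) (a + H)) ≤
      K * A * μ.real (Ioc (a - 2 * H) (a - H)) := by
    intro a H hH
    have hN : 0 < ν.real (Ioc (a - 2 * H) (a - H)) ^ r :=
      Real.rpow_pos_of_pos (νpos _ _ (by linarith)) _
    refine le_of_mul_le_mul_right ?_ hN
    calc _ ≤ _ := R1 a H hH
      _ = A * K * H ^ (1 + r) := by ring
      _ ≤ A * K * _ := mul_le_mul_of_nonneg_left (R2 a H hH) (by positivity)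
      _ = _ := by ring
  have add : ∀ x y z : ℝ, x ≤ y → y ≤ z →
      μ.real (Ioc x z) = μ.real (Ioc x y) + μ.real (Ioc y z) := by
    intro x y z hxy hyz
    rw [← Ioc_union_Ioc_eq_Ioc hxy hyz, measureReal_union _ measurableSet_Ioc (μt' _ _) (μt' _ _)]
    exact Set.disjoint_left.2 fun t h1 h2 => by
      have := h1.2; have := h2.1; linarith
  have hKA : 1 ≤ K * A := by
    by_contra hlt
    push Not at hlt
    have hc := μpos (1/2) 1 (by norm_num)
    have J : ∀ k : ℕ, μ.real (Ioc (1/2) 1) ≤ μ.real (Ioc ((1/2) ^ (k+1)) ((1/2) ^ k)) := by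
      intro k
      induction k with
      | zero => simp
      | succ k ih =>
        have hp : (0:ℝ) < (1/2) ^ k := by positivity
        have := D (3/4 * (1/2)^k) (1/4 * (1/2)^k) (by positivity)
        rw [show 3/4 * (1/2:ℝ)^k - 1/4 * (1/2)^k = (1/2)^(k+1) by ring,
          show 3/4 * (1/2:ℝ)^k + 1/4 * (1/2)^k = (1/2)^k by ring,
          show 3/4 * (1/2:ℝ)^k - 2 * (1/4 * (1/2)^k) = (1/2)^(k+1+1) by ring] at this
        refine ih.trans (this.trans ?_)
        exact mul_le_of_le_one_left measureReal_nonneg hlt.le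
    have S : ∀ k : ℕ, k * μ.real (Ioc (1/2) 1) + μ.real (Ioc 0 ((1/2) ^ k)) ≤ μ.real (Ioc 0 1) := by
      intro k
      induction k with
      | zero => simp
      | succ k ih =>
        have hp : (0:ℝ) < (1/2) ^ k := by positivity
        rw [add 0 ((1/2)^(k+1)) ((1/2)^k) (by positivity) (by rw [pow_succ]; linarith)] at ih
        have := J k
        push_cast
        linarith
    obtain ⟨n, hn⟩ := exists_nat_gt (μ.real (Ioc 0 1) / μ.real (Ioc (1/2) 1))
    rw [div_lt_iff₀ hc] at hn
    have := S n
    have : 0 ≤ μ.real (Ioc 0 ((1/2) ^ n)) := measureReal_nonneg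
    linarith
  have hA0 : 0 < A := by
    rcases hA.eq_or_lt with h | h
    · rw [← h] at hKA; linarith
    · exact h
  set τ := 1 / r with hτd
  have hτ : 0 < τ := by positivity
  obtain ⟨g1, g2⟩ := glo_geom τ K A hτ hK hA0 hKA
  set δ := 1 / (K * A) with hδ
  have hδ0 : 0 < δ := by positivity
  set ρ := (1 + δ) ^ (-τ) with hρ
  have hρ0 : 0 < ρ := by positivity
  set M := μ.real (Ioc (a - h) (a + h)) with hM
  have hM0 : 0 < M := μpos _ _ (by linarith)
  have G : ∀ k : ℕ, (1 + δ) ^ k * M ≤ μ.real (Ioc (a - 2 ^ k * h) (a + 2 ^ k * h)) := by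
    intro k
    induction k with
    | zero => simp [hM]
    | succ k ih =>
      have hH : 0 < 2 ^ k * h := by positivity
      have d := D a (2 ^ k * h) hH
      have e1 := add (a - 2 * (2 ^ k * h)) (a - 2 ^ k * h) (a + 2 ^ k * h)
        (by linarith) (by linarith)
      have e2 : μ.real (Ioc (a - 2 * (2 ^ k * h)) (a + 2 ^ k * h)) ≤
          μ.real (Ioc (a - 2 * (2 ^ k * h)) (a + 2 * (2 ^ k * h))) :=
        measureReal_mono (Ioc_subset_Ioc_right (by linarith)) (μt' _ _)
      rw [show (2:ℝ) ^ (k+1) * h = 2 * (2 ^ k * h) by ring]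
      have e3 : δ * μ.real (Ioc (a - 2 ^ k * h) (a + 2 ^ k * h)) ≤
          μ.real (Ioc (a - 2 * (2 ^ k * h)) (a - 2 ^ k * h)) := by
        rw [hδ, div_mul_eq_mul_div, one_mul, div_le_iff₀ (by positivity)]
        linarith
      calc (1 + δ) ^ (k+1) * M = (1 + δ) * ((1 + δ) ^ k * M) := by ring
        _ ≤ (1 + δ) * μ.real (Ioc (a - 2 ^ k * h) (a + 2 ^ k * h)) := by gcongr
        _ ≤ _ := by linarith
  set E := 2 ^ (1 + τ) * A ^ τ * M ^ (-τ) with hE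
  have hE0 : 0 < E := by positivity
  have T : ∀ k : ℕ, (2 ^ k * h) ^ (-(1 + τ)) *
      ν.real (Ioc (a - 2 ^ (k+1) * h) (a - 2 ^ k * h)) ≤ E * ρ ^ k := by
    intro k
    have hH : 0 < 2 ^ k * h := by positivity
    rw [show (2:ℝ) ^ (k+1) * h = 2 * (2 ^ k * h) by ring]
    have r1 := R1 a _ hH
    set H := 2 ^ k * h with hHd
    set N := ν.real (Ioc (a - 2 * H) (a - H)) with hN
    have hN0 : 0 ≤ N := measureReal_nonneg
    set X := (1 + δ) ^ k * M with hX
    have hX0 : 0 < X := by positivity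
    have r2 : N ^ r ≤ A * (K * H ^ (1 + r)) * X⁻¹ := by
      rw [← div_eq_mul_inv, le_div_iff₀ hX0, mul_comm]
      refine le_trans ?_ r1
      gcongr
      exact G k
    have r3 : N ≤ (A * (K * H ^ (1 + r)) * X⁻¹) ^ τ := by
      calc N = (N ^ r) ^ τ := by
            rw [← Real.rpow_mul hN0, hτd, mul_one_div_cancel hr0.ne', Real.rpow_one]
        _ ≤ _ := Real.rpow_le_rpow (by positivity) r2 hτ.le
    have hexp : (1 + r) * τ = 1 + τ := by rw [hτd]; field_simp; ring
    have r4 : (A * (K * H ^ (1 + r)) * X⁻¹) ^ τ =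
        A ^ τ * (2 ^ (1 + τ) * H ^ (1 + τ)) * (M ^ (-τ) * ρ ^ k) := by
      rw [Real.mul_rpow (by positivity) (by positivity), Real.mul_rpow hA0.le (by positivity),
        Real.mul_rpow hK.le (by positivity), hKd, ← Real.rpow_mul (by norm_num),
        ← Real.rpow_mul hH.le, hexp, Real.inv_rpow hX0.le, ← Real.rpow_neg hX0.le, hX,
        Real.mul_rpow (by positivity) hM0.le, hρ, ← Real.rpow_natCast, ← Real.rpow_natCast,
        ← Real.rpow_mul (by positivity), ← Real.rpow_mul (by positivity), mul_comm (k:ℝ),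
        mul_comm (M ^ (-τ))]
    rw [r4] at r3
    calc H ^ (-(1 + τ)) * N ≤ H ^ (-(1 + τ)) *
          (A ^ τ * (2 ^ (1 + τ) * H ^ (1 + τ)) * (M ^ (-τ) * ρ ^ k)) := by gcongr
      _ = (H ^ (-(1 + τ)) * H ^ (1 + τ)) * (E * ρ ^ k) := by rw [hE]; ring
      _ = E * ρ ^ k := by
        rw [← Real.rpow_add hH, neg_add_cancel, Real.rpow_zero, one_mul]
  have cover : Iio (a - h) ⊆ ⋃ k : ℕ, Ioc (a - 2 ^ (k+1) * h) (a - 2 ^ k * h) := by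
    intro t ht
    have ht' : t < a - h := ht
    obtain ⟨k, hk1, hk2⟩ := exists_nat_pow_near (x := (a - t) / h) (y := 2)
      (by rw [le_div_iff₀ hh]; linarith) (by norm_num)
    rw [le_div_iff₀ hh] at hk1
    rw [div_lt_iff₀ hh] at hk2
    exact mem_iUnion.2 ⟨k, by linarith, by linarith⟩
  have I : ∫⁻ t in Iio (a - h), ENNReal.ofReal ((a - t) ^ (-(1 + τ))) ∂ν ≤
      ENNReal.ofReal (E * (1 - ρ)⁻¹) := by
    calc _ ≤ ∫⁻ t in ⋃ k : ℕ, Ioc (a - 2 ^ (k+1) * h) (a - 2 ^ k * h),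
            ENNReal.ofReal ((a - t) ^ (-(1 + τ))) ∂ν := lintegral_mono_set cover
      _ ≤ ∑' k : ℕ, ∫⁻ t in Ioc (a - 2 ^ (k+1) * h) (a - 2 ^ k * h),
            ENNReal.ofReal ((a - t) ^ (-(1 + τ))) ∂ν := lintegral_iUnion_le _ _
      _ ≤ ∑' k : ℕ, ENNReal.ofReal (E * ρ ^ k) := by
        refine ENNReal.tsum_le_tsum fun k => ?_
        have hH : 0 < 2 ^ k * h := by positivity
        calc _ ≤ ∫⁻ t in Ioc (a - 2 ^ (k+1) * h) (a - 2 ^ k * h),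
              ENNReal.ofReal ((2 ^ k * h) ^ (-(1 + τ))) ∂ν := by
              refine setLIntegral_mono' measurableSet_Ioc fun t ht => ?_
              refine ENNReal.ofReal_le_ofReal ?_
              have := ht.2
              exact Real.rpow_le_rpow_of_nonpos hH (by linarith) (by linarith)
          _ = ENNReal.ofReal ((2 ^ k * h) ^ (-(1 + τ)) *
              ν.real (Ioc (a - 2 ^ (k+1) * h) (a - 2 ^ k * h))) := by
              rw [setLIntegral_const, ENNReal.ofReal_mul (by positivity),
                ofReal_measureReal (νt' _ _)]
          _ ≤ _ := ENNReal.ofReal_le_ofReal (T k)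
      _ = ENNReal.ofReal (E * (1 - ρ)⁻¹) := by
        rw [← ENNReal.ofReal_tsum_of_nonneg (fun k => by positivity)
          ((summable_geometric_of_lt_one hρ0.le g1).mul_left E), tsum_mul_left,
          tsum_geometric_of_lt_one hρ0.le g1]
  have hm : 0 < min 1 τ := lt_min one_pos hτ
  set C := 2 * K / min 1 τ with hC
  have hC0 : 0 < C := by positivity
  have I2 := I.trans (ENNReal.ofReal_le_ofReal (mul_le_mul_of_nonneg_left g2 hE0.le))
  rw [← ofReal_measureReal (μt' _ _), ← hM, ENNReal.ofReal_rpow_of_pos hM0]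
  calc _ ≤ ENNReal.ofReal (M ^ (1 / q)) * ENNReal.ofReal (E * (C * A)) ^ (1 / s) := by
        gcongr
    _ = ENNReal.ofReal (M ^ (1 / q) * (E * (C * A)) ^ (1 / s)) := by
        rw [ENNReal.ofReal_rpow_of_pos (by positivity), ← ENNReal.ofReal_mul (by positivity)]
    _ = ENNReal.ofReal ((2 ^ (1 + τ) * C) ^ (1 / s) * A ^ (1 / q + 1 / s)) := by
        congr 1
        rw [show E * (C * A) = (2 ^ (1 + τ) * C) * (A ^ τ * A ^ (1:ℝ)) * M ^ (-τ) by
            rw [hE, Real.rpow_one]; ring,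
          Real.mul_rpow (by positivity) (by positivity),
          Real.mul_rpow (by positivity) (by positivity), ← Real.rpow_add hA0,
          ← Real.rpow_mul hA0.le, ← Real.rpow_mul hM0.le,
          show (τ + 1) * (1 / s) = 1 / q + 1 / s by rw [hτd, hr]; field_simp,
          show -τ * (1 / s) = -(1 / q) by rw [hτd, hr]; field_simp,
          Real.rpow_neg hM0.le]
        have : M ^ (1 / q) ≠ 0 := by positivity
        field_simp
    _ = _ := by rw [ENNReal.ofReal_mul (by positivity)]

theorem glo_minus_bound (α p q : ℝ) (hα1 : α < 1) (hp : 1 < p) (hq0 : 0 < q)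
    (hq : 1 / q = 1 / p - α) (c : ℝ) (hc : 0 < c)
    (hcd : c = (2 ^ (1 + 1 / (q / (p / (p - 1)))) * (2 * 2 ^ (1 + q / (p / (p - 1))) /
      min 1 (1 / (q / (p / (p - 1)))))) ^ (1 / (p / (p - 1))))
    (w : ℝ → ℝ) (hw : ∀ᵐ x : ℝ, 0 < w x) (hwm : AEMeasurable w volume) :
    gloMinus α p q (fun t => w t ^ q) (fun t => w t ^ p) ≤
      ENNReal.ofReal c * apqMinusChar p q w ^ (1 - α) := by
  have hp1 : 0 < p - 1 := by linarith
  have hs2 : 1 - 1 / p = 1 / (p / (p - 1)) := by field_simp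
  have hs3 : p * (1 - p / (p - 1)) = -(p / (p - 1)) := by field_simp; ring
  unfold gloMinus
  rw [hs2]
  have hsum : 1 - α = 1 / q + 1 / (p / (p - 1)) := by rw [← hs2, hq]; ring
  have hs : 0 < p / (p - 1) := by positivity
  obtain ⟨A0, hA0⟩ : ∃ A0, A0 = apqMinusChar p q w := ⟨_, rfl⟩
  have hA1 : ∀ x h : ℝ, 0 < h → avgIoc (fun t => w t ^ q) x (x + h) *
      avgIoc (fun t => w t ^ (-(p / (p - 1)))) (x - h) x ^ (q / (p / (p - 1))) ≤ A0 := by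
    intro x h hh
    rw [hA0]
    unfold apqMinusChar
    exact le_iSup_of_le x (le_iSup_of_le h (le_iSup_of_le hh le_rfl))
  rw [← hA0]
  by_cases htop : A0 = ⊤
  · rw [htop, ENNReal.top_rpow_of_pos (by linarith), ENNReal.mul_top (by simpa using hc)]
    exact le_top
  have hexp : (α - 1) * (p / (p - 1)) = -(1 + 1 / (q / (p / (p - 1)))) := by
    have : α - 1 = -(1 / q + 1 / (p / (p - 1))) := by linarith
    rw [this]
    field_simp
    ring
  refine iSup_le fun a => iSup_le fun h => iSup_le fun hh => ?_
  rw [hexp, hsum, hcd]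
  simp only [← hs3] at hA1
  have hws : ∀ᵐ t, (w t ^ p) ^ (1 - p / (p - 1)) = w t ^ (-(p / (p - 1))) := by
    filter_upwards [hw] with t ht
    rw [← Real.rpow_mul ht.le, hs3]
  simp only [hs3] at hA1
  generalize hsd : p / (p - 1) = s at *
  set r := q / s with hr
  have hr0 : 0 < r := by positivity
  set u : ℝ → ℝ≥0∞ := fun t => ENNReal.ofReal (w t ^ q) with hu
  set σ : ℝ → ℝ≥0∞ := fun t => ENNReal.ofReal (w t ^ (-s)) with hσ
  have hum : AEMeasurable u volume := (hwm.pow_const q).ennreal_ofReal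
  have hσm : AEMeasurable σ volume := (hwm.pow_const (-s)).ennreal_ofReal
  have huσ : ∀ᵐ t, u t ^ (1 / (1 + r)) * σ t ^ (r / (1 + r)) = 1 := by
    filter_upwards [hw] with t ht
    simp only [hu, hσ]
    rw [ENNReal.ofReal_rpow_of_pos (by positivity), ENNReal.ofReal_rpow_of_pos (by positivity),
      ← ENNReal.ofReal_mul (by positivity), ← Real.rpow_mul ht.le, ← Real.rpow_mul ht.le,
      ← Real.rpow_add ht, show q * (1 / (1 + r)) + -s * (r / (1 + r)) = 0 by
        rw [hr]; field_simp; ring, Real.rpow_zero, ENNReal.ofReal_one]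
  have key := glo_core q s r hq0 hs hr (volume.withDensity u) (volume.withDensity σ)
    A0.toReal ENNReal.toReal_nonneg ?_ ?_ a h hh
  · rw [withDensity_apply _ measurableSet_Ioc] at key
    rw [← ENNReal.ofReal_rpow_of_nonneg (x := A0.toReal) ENNReal.toReal_nonneg (by positivity),
      ENNReal.ofReal_toReal htop] at key
    refine le_trans (le_of_eq ?_) key
    congr 2
    rw [setLIntegral_withDensity_eq_setLIntegral_mul_non_measurable₀ _ _ _ measurableSet_Iio]
    · refine setLIntegral_congr_fun_ae measurableSet_Iio ?_
      filter_upwards [hws] with t ht hta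
      have : 0 < a - t := by have : t < a - h := hta; linarith
      rw [Pi.mul_apply, ht, ENNReal.ofReal_mul (by positivity), mul_comm]
    · exact Eventually.of_forall fun t => ENNReal.ofReal_lt_top
    · exact hσm.restrict
  · intro x h hh
    have h1 := hA1 x h hh
    rw [withDensity_apply _ measurableSet_Ioc, withDensity_apply _ measurableSet_Ioc]
    unfold avgIoc lintIoc at h1
    rw [add_sub_cancel_left, sub_sub_cancel, ENNReal.mul_rpow_of_nonneg _ _ hr0.le] at h1
    have e : ENNReal.ofReal (h ^ (1 + r)) = ENNReal.ofReal h * ENNReal.ofReal h ^ r := by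
      rw [Real.rpow_add hh, Real.rpow_one, ENNReal.ofReal_mul hh.le, ENNReal.ofReal_rpow_of_pos hh]
    rw [ENNReal.ofReal_mul ENNReal.toReal_nonneg, ENNReal.ofReal_toReal htop, e]
    have hH0 : ENNReal.ofReal h ≠ 0 := by simpa using hh
    have hHt : ENNReal.ofReal h ≠ ⊤ := ENNReal.ofReal_ne_top
    generalize ENNReal.ofReal h = Y at *
    have hY1 : Y * Y⁻¹ = 1 := ENNReal.mul_inv_cancel hH0 hHt
    have hY2 : Y ^ r * Y⁻¹ ^ r = 1 := by
      rw [← ENNReal.mul_rpow_of_nonneg _ _ hr0.le, hY1, ENNReal.one_rpow]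
    calc _ = (Y * Y⁻¹) * (Y ^ r * Y⁻¹ ^ r) * ((∫⁻ t in Ioc x (x + h), u t) *
          (∫⁻ t in Ioc (x - h) x, σ t) ^ r) := by rw [hY1, hY2, one_mul, one_mul]
      _ = (Y⁻¹ * (∫⁻ t in Ioc x (x + h), u t) *
          (Y⁻¹ ^ r * (∫⁻ t in Ioc (x - h) x, σ t) ^ r)) * (Y * Y ^ r) := by ring
      _ ≤ _ := by gcongr
  · intro x h hh
    rw [withDensity_apply _ measurableSet_Ioc, withDensity_apply _ measurableSet_Ioc]
    have hconj : (1 + r).HolderConjugate ((1 + r) / r) := by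
      rw [Real.holderConjugate_iff]
      refine ⟨by linarith, by field_simp⟩
    have hol := ENNReal.lintegral_mul_le_Lp_mul_Lq (volume.restrict (Ioc x (x + h))) hconj
      (f := fun t => u t ^ (1 / (1 + r))) (g := fun t => σ t ^ (r / (1 + r)))
      (hum.restrict.pow_const _) (hσm.restrict.pow_const _)
    have e1 : ∫⁻ t in Ioc x (x + h), ((fun t => u t ^ (1 / (1 + r))) *
        (fun t => σ t ^ (r / (1 + r)))) t = ENNReal.ofReal h := by
      refine (lintegral_congr_ae (g := fun _ => 1) (ae_restrict_of_ae huσ)).trans ?_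
      simp
    have e2 : ∀ t, (u t ^ (1 / (1 + r))) ^ (1 + r) = u t := fun t => by
      rw [← ENNReal.rpow_mul, one_div_mul_cancel (by positivity), ENNReal.rpow_one]
    have e3 : ∀ t, (σ t ^ (r / (1 + r))) ^ ((1 + r) / r) = σ t := fun t => by
      rw [← ENNReal.rpow_mul, show r / (1 + r) * ((1 + r) / r) = 1 by field_simp, ENNReal.rpow_one]
    rw [e1] at hol
    simp only [e2, e3] at hol
    rw [← ENNReal.ofReal_rpow_of_pos hh]
    refine (ENNReal.rpow_le_rpow hol (by positivity : 0 ≤ 1 + r)).trans (le_of_eq ?_)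
    rw [ENNReal.mul_rpow_of_nonneg _ _ (by positivity), ← ENNReal.rpow_mul, ← ENNReal.rpow_mul,
      one_div_mul_cancel (by positivity), ENNReal.rpow_one]
    congr 2
    field_simp

theorem glo_lint_neg (f : ℝ → ℝ≥0∞) (s : Set ℝ) (hs : MeasurableSet s) :
    ∫⁻ t in s, f (-t) = ∫⁻ t in (fun t => -t) ⁻¹' s, f t := by
  have h := (Measure.measurePreserving_neg (volume : Measure ℝ)).setLIntegral_comp_preimage_emb
    (MeasurableEquiv.neg ℝ).measurableEmbedding f ((fun t => -t) ⁻¹' s)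
  rw [← h]
  congr 2
  ext t
  simp

theorem glo_lint_neg_Ioc (f : ℝ → ℝ≥0∞) (a b : ℝ) :
    ∫⁻ t in Ioc a b, f (-t) = ∫⁻ t in Ioc (-b) (-a), f t := by
  rw [glo_lint_neg f _ measurableSet_Ioc]
  have : (fun t : ℝ => -t) ⁻¹' Ioc a b = Ico (-b) (-a) := by
    ext t
    simp only [mem_preimage, mem_Ioc, mem_Ico]
    constructor <;> rintro ⟨h1, h2⟩ <;> constructor <;> linarith
  rw [this]
  exact setLIntegral_congr Ico_ae_eq_Ioc

theorem glo_lint_neg_Iio (f : ℝ → ℝ≥0∞) (a : ℝ) :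
    ∫⁻ t in Iio a, f (-t) = ∫⁻ t in Ioi (-a), f t := by
  rw [glo_lint_neg f _ measurableSet_Iio]
  have : (fun t : ℝ => -t) ⁻¹' Iio a = Ioi (-a) := by
    ext t
    simp only [mem_preimage, mem_Iio, mem_Ioi]
    constructor <;> intro h <;> linarith
  rw [this]

theorem glo_avg_neg (f : ℝ → ℝ) (a b : ℝ) :
    avgIoc (fun t => f (-t)) a b = avgIoc f (-b) (-a) := by
  unfold avgIoc lintIoc
  rw [glo_lint_neg_Ioc (fun t => ENNReal.ofReal (f t)), show -a - -b = b - a by ring]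

theorem glo_apq_neg (p q : ℝ) (w : ℝ → ℝ) :
    apqMinusChar p q (fun t => w (-t)) ≤ apqPlusChar p q w := by
  unfold apqMinusChar apqPlusChar
  refine iSup_le fun x => iSup_le fun h => iSup_le fun hh => ?_
  refine le_iSup_of_le (-x) (le_iSup_of_le h (le_iSup_of_le hh (le_of_eq ?_)))
  rw [glo_avg_neg (fun t => w t ^ q), glo_avg_neg (fun t => w t ^ (-(p / (p - 1)))),
    show -(x + h) = -x - h by ring, show -(x - h) = -x + h by ring]

theorem glo_plus_neg (α p q : ℝ) (v w : ℝ → ℝ) :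
    gloPlus α p q v w ≤ gloMinus α p q (fun t => v (-t)) (fun t => w (-t)) := by
  unfold gloPlus gloMinus
  refine iSup_le fun a => iSup_le fun h => iSup_le fun hh => ?_
  refine le_iSup_of_le (-a) (le_iSup_of_le h (le_iSup_of_le hh (le_of_eq ?_)))
  rw [glo_lint_neg_Ioc (fun t => ENNReal.ofReal (v t)),
    show -(-a + h) = a - h by ring, show -(-a - h) = a + h by ring]
  have := glo_lint_neg_Iio (fun t => ENNReal.ofReal ((t - a) ^ ((α - 1) * (p / (p - 1))) *
            w t ^ (1 - p / (p - 1)))) (-a - h)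
  rw [show -(-a - h) = a + h by ring] at this
  rw [← this]
  simp only [show ∀ t : ℝ, -t - a = -a - t from fun t => by ring]

/-- `[w^q, w^p]^±_{Glo}(p,q) ≤ c ‖w‖_{A_{p,q}^±(ℝ)}^{1-α}` with `c = c(p,α)`. -/
theorem stmt6 (α p q : ℝ) (hα : 0 < α) (hα1 : α < 1) (hp : 1 < p) (hpα : p < 1 / α)
    (hq : 1 / q = 1 / p - α) :
    ∃ c : ℝ, 0 < c ∧
      ∀ w : ℝ → ℝ, IsWeight w →
        gloMinus α p q (fun t => w t ^ q) (fun t => w t ^ p) ≤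
            ENNReal.ofReal c * apqMinusChar p q w ^ (1 - α) ∧
          gloPlus α p q (fun t => w t ^ q) (fun t => w t ^ p) ≤
            ENNReal.ofReal c * apqPlusChar p q w ^ (1 - α) := by
  have hp1 : 0 < p - 1 := by linarith
  have hq0 : 0 < q := by
    have h1 : α < 1 / p := by
      rw [lt_div_iff₀ hα] at hpα
      rw [lt_div_iff₀ (by linarith)]
      linarith
    exact one_div_pos.1 (by linarith)
  have hs : 0 < p / (p - 1) := by positivity
  have hr : 0 < 1 / (q / (p / (p - 1))) := by positivity
  have hm : 0 < min 1 (1 / (q / (p / (p - 1)))) := lt_min one_pos hr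
  have hc : 0 < ((2:ℝ) ^ (1 + 1 / (q / (p / (p - 1)))) * (2 * 2 ^ (1 + q / (p / (p - 1))) /
      min 1 (1 / (q / (p / (p - 1)))))) ^ (1 / (p / (p - 1))) := by positivity
  refine ⟨_, hc, fun w hw => ⟨?_, ?_⟩⟩
  · exact glo_minus_bound α p q hα1 hp hq0 hq _ hc rfl w hw.1
      hw.2.aestronglyMeasurable.aemeasurable
  · have hmp := Measure.measurePreserving_neg (volume : Measure ℝ)
    refine (glo_plus_neg α p q _ _).trans ((glo_minus_bound α p q hα1 hp hq0 hq _ hc rfl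
      (fun t => w (-t)) (hmp.quasiMeasurePreserving.ae hw.1)
      (hw.2.aestronglyMeasurable.aemeasurable.comp_quasiMeasurePreserving
        hmp.quasiMeasurePreserving)).trans ?_)
    exact mul_le_mul_right (ENNReal.rpow_le_rpow (glo_apq_neg p q w) (by linarith)) _

end
end
end
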